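/- arXiv:1609.09793 — 2 statements merged into one kernel-verified Lean document; each statement's English description precedes it below -/
import Mathlib

section
/- Let ℓ be a prime and K₀ a real quadratic number field. Set A = K₀ ⊗_ℚ ℚ_ℓ, let R₀ be the ℤ_ℓ-subalgebra of A generated by the image of the ring of integers O_{K₀}, and for n ≥ 0 let R_n = ℤ_ℓ + ℓⁿR₀. Let V be a 4-dimensional ℚ_ℓ-vector space with a symplectic form B, equipped with an A-module structure extending its ℚ_ℓ-vector space structure and satisfying B(x·u, v) = B(u, x·v) for all x ∈ A and u, v ∈ V. Let Λ be a self-dual full ℤ_ℓ-lattice in V whose real order {x ∈ A : x·Λ ⊆ Λ} equals R_n. Then Λ is a free R_n-module of rank 2. -/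
open scoped TensorProduct

/-- The maximal order `R₀ = O_{K₀} ⊗ ℤ_ℓ` of `A = K₀ ⊗_ℚ ℚ_ℓ`: the `ℤ_ℓ`-subalgebra of `A`
generated by the image of the ring of integers of `K₀`. -/
noncomputable def maxRealLocalOrder (ℓ : ℕ) [Fact ℓ.Prime] (K₀ : Type*) [Field K₀]
    [NumberField K₀] : Subalgebra ℤ_[ℓ] (ℚ_[ℓ] ⊗[ℚ] K₀) :=
  Algebra.adjoin ℤ_[ℓ]
    (Set.range fun a : NumberField.RingOfIntegers K₀ =>
      (Algebra.TensorProduct.includeRight : K₀ →ₐ[ℚ] ℚ_[ℓ] ⊗[ℚ] K₀)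
        (algebraMap (NumberField.RingOfIntegers K₀) K₀ a))

/-- The order `R_n = ℤ_ℓ + ℓⁿ R₀` of `A = K₀ ⊗_ℚ ℚ_ℓ`, as a subset of `A`. -/
noncomputable def realOrderLevel (ℓ : ℕ) [Fact ℓ.Prime] (K₀ : Type*) [Field K₀]
    [NumberField K₀] (n : ℕ) : Set (ℚ_[ℓ] ⊗[ℚ] K₀) :=
  {x : ℚ_[ℓ] ⊗[ℚ] K₀ | ∃ c : ℤ_[ℓ], ∃ y ∈ maxRealLocalOrder ℓ K₀,
    x = algebraMap ℤ_[ℓ] (ℚ_[ℓ] ⊗[ℚ] K₀) c + (ℓ : ℚ_[ℓ] ⊗[ℚ] K₀) ^ n * y}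

/-- If an endomorphism preserves every line modulo a generator `p` of a maximal ideal, then it is
a scalar modulo `p`. -/
theorem exists_forall_sub_smul_of_forall_exists {R M : Type*} [CommRing R] [AddCommGroup M]
    [Module R M] (p : R) [hp : (Ideal.span {p}).IsMaximal] (f : M →ₗ[R] M)
    (h : ∀ v, ∃ c : R, ∃ y, f v - c • v = p • y) :
    ∃ c : R, ∀ v, ∃ y, f v - c • v = p • y := by
  let _ : Field (R ⧸ Ideal.span {p}) := Ideal.Quotient.field _
  let N : Submodule R M := Ideal.span {p} • (⊤ : Submodule R M)
  have hN : ∀ x, x ∈ N ↔ ∃ y, x = p • y := by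
    intro x
    simp only [N, Submodule.ideal_span_singleton_smul, Submodule.mem_smul_pointwise_iff_exists]
    constructor
    · rintro ⟨y, -, rfl⟩
      exact ⟨y, rfl⟩
    · rintro ⟨y, rfl⟩
      exact ⟨y, trivial, rfl⟩
  have hle : N ≤ N.comap f := by
    intro x hx
    obtain ⟨y, rfl⟩ := (hN x).1 hx
    exact (hN _).2 ⟨f y, by simp⟩
  let g : (M ⧸ N) →ₗ[R ⧸ Ideal.span {p}] (M ⧸ N) :=
    { toFun := N.mapQ N f hle
      map_add' := map_add _
      map_smul' := by
        intro c x
        obtain ⟨c, rfl⟩ := Ideal.Quotient.mk_surjective c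
        exact (N.mapQ N f hle).map_smul c x }
  have hg : ∀ v, g (N.mkQ v) = N.mkQ (f v) := fun v => rfl
  obtain ⟨a, ha⟩ := LinearMap.exists_eq_smul_id_of_forall_notLinearIndependent (f := g) (by
    intro x hx
    obtain ⟨v, rfl⟩ := N.mkQ_surjective x
    obtain ⟨c, y, hy⟩ := h v
    have h0 : N.mkQ (f v - c • v) = 0 := by
      rw [Submodule.mkQ_apply, Submodule.Quotient.mk_eq_zero]
      exact (hN _).2 ⟨y, hy⟩
    have h1 := LinearIndependent.pair_iff.1 hx (-Ideal.Quotient.mk _ c) 1 (by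
      rw [hg, one_smul, neg_smul, neg_add_eq_sub, ← h0, map_sub]
      rfl)
    exact one_ne_zero h1.2)
  obtain ⟨c, rfl⟩ := Ideal.Quotient.mk_surjective a
  refine ⟨c, fun v => (hN _).1 ?_⟩
  rw [← Submodule.Quotient.mk_eq_zero, ← Submodule.mkQ_apply, map_sub, ← hg, ha]
  exact sub_self _

/-- The ring of integers of a quadratic number field is monogenic. -/
theorem exists_monogenic_ringOfIntegers (K₀ : Type*) [Field K₀] [NumberField K₀]
    (hdeg : Module.finrank ℚ K₀ = 2) :
    ∃ ω : NumberField.RingOfIntegers K₀,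
      (∀ x : NumberField.RingOfIntegers K₀, ∃ a b : ℤ, x = a + b * ω) ∧
      LinearIndependent ℚ ![(1 : K₀), (ω : K₀)] := by
  have hr : Module.finrank ℤ (NumberField.RingOfIntegers K₀) = 2 := by
    rw [NumberField.RingOfIntegers.rank, hdeg]
  let b := Module.finBasisOfFinrankEq ℤ (NumberField.RingOfIntegers K₀) hr
  have hb : ∀ x, ∃ r s : ℤ, x = r * b 0 + s * b 1 := fun x =>
    ⟨b.repr x 0, b.repr x 1, by simpa [zsmul_eq_mul] using (b.sum_repr x).symm⟩
  obtain ⟨a, c, hac⟩ := hb 1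
  have hcop : IsCoprime a c := by
    rw [Int.isCoprime_iff_gcd_eq_one]
    obtain ⟨a', ha'⟩ := Int.gcd_dvd_left a c
    obtain ⟨c', hc'⟩ := Int.gcd_dvd_right a c
    set d := Int.gcd a c
    have h1 : algebraMap ℤ (NumberField.RingOfIntegers K₀) d * (a' * b 0 + c' * b 1) = 1 := by
      rw [hac, ha', hc']
      simp
      ring
    have h2 := congrArg (Algebra.norm ℤ) h1
    rw [map_mul, map_one (Algebra.norm ℤ (S := NumberField.RingOfIntegers K₀)), Algebra.norm_algebraMap, hr] at h2
    have h3 : IsUnit ((d : ℤ) ^ 2) := IsUnit.of_mul_eq_one _ h2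
    have h4 := (isUnit_pow_iff two_ne_zero).1 h3
    exact_mod_cast Int.isUnit_iff_natAbs_eq.1 h4
  obtain ⟨u, v, huv⟩ := hcop
  have huv' : (u : NumberField.RingOfIntegers K₀) * a + v * c = 1 := by exact_mod_cast huv
  have hspan : ∀ x : NumberField.RingOfIntegers K₀,
      ∃ r s : ℤ, x = r + s * (-v * b 0 + u * b 1) := by
    intro x
    obtain ⟨r, s, rfl⟩ := hb x
    refine ⟨r * u + s * v, -r * c + s * a, ?_⟩
    push_cast
    linear_combination (-(r * b 0 + s * b 1)) * huv' + (-(r * u + s * v)) * hac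
  refine ⟨_, hspan, ?_⟩
  apply linearIndependent_of_top_le_span_of_card_eq_finrank
  · rw [← (NumberField.integralBasis K₀).span_eq, Submodule.span_le]
    rintro _ ⟨i, rfl⟩
    obtain ⟨r, s, hrs⟩ := hspan (NumberField.RingOfIntegers.basis K₀ i)
    rw [NumberField.integralBasis_apply, hrs, SetLike.mem_coe, Matrix.range_cons,
      Matrix.range_cons, Matrix.range_empty, Set.union_empty, Set.singleton_union,
      Submodule.mem_span_pair]
    refine ⟨r, s, ?_⟩
    simp only [Rat.smul_def, Rat.cast_intCast, mul_one, map_add, map_mul, map_intCast]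
  · simp [hdeg]

/-- A vector of a self-dual lattice that is not divisible by `ℓ` in the lattice pairs to `1` with
some lattice vector. -/
theorem exists_pairing_eq_one_of_selfDual {ℓ : ℕ} [Fact ℓ.Prime] {V : Type*} [AddCommGroup V]
    [Module ℚ_[ℓ] V] [Module ℤ_[ℓ] V] [IsScalarTower ℤ_[ℓ] ℚ_[ℓ] V]
    (B : V →ₗ[ℚ_[ℓ]] V →ₗ[ℚ_[ℓ]] ℚ_[ℓ]) (Λ : Submodule ℤ_[ℓ] V)
    (hsd : (Λ : Set V) = {v : V | ∀ w ∈ Λ, ∃ c : ℤ_[ℓ], B v w = (c : ℚ_[ℓ])})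
    {v : V} (hv : v ∈ Λ) (hndvd : ∀ y ∈ Λ, v ≠ (ℓ : ℤ_[ℓ]) • y) :
    ∃ w ∈ Λ, B v w = 1 := by
  have hℓ : (ℓ : ℚ_[ℓ]) ≠ 0 := by exact_mod_cast (Fact.out : ℓ.Prime).ne_zero
  have hsm : ∀ (c : ℤ_[ℓ]) (x : V), c • x = (c : ℚ_[ℓ]) • x := fun c x =>
    algebra_compatible_smul ℚ_[ℓ] c x
  by_contra! hne
  have hmem : (ℓ : ℚ_[ℓ])⁻¹ • v ∈ (Λ : Set V) := by
    rw [hsd]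
    intro w hw
    have hv' : v ∈ (Λ : Set V) := hv
    rw [hsd] at hv'
    obtain ⟨c, hc⟩ := hv' w hw
    have hcu : ¬ IsUnit c := by
      intro hu
      obtain ⟨d, hd⟩ := hu.exists_right_inv
      refine hne (d • w) (Λ.smul_mem d hw) ?_
      rw [hsm, map_smul, hc, smul_eq_mul, mul_comm]
      rw [← PadicInt.coe_mul, hd, PadicInt.coe_one]
    have hdvd : (ℓ : ℤ_[ℓ]) ∣ c := by
      rw [← PadicInt.norm_lt_one_iff_dvd]
      exact PadicInt.mem_nonunits.1 hcu
    obtain ⟨d, rfl⟩ := hdvd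
    refine ⟨d, ?_⟩
    rw [map_smul, LinearMap.smul_apply, hc, smul_eq_mul]
    push_cast
    field_simp
  refine hndvd _ hmem ?_
  rw [hsm, PadicInt.coe_natCast, smul_smul, mul_inv_cancel₀ hℓ, one_smul]

/-- Let `T` be a self-adjoint endomorphism satisfying a monic quadratic equation that preserves a
self-dual lattice of rank 4 and is not a scalar modulo `ℓ`.  Then the lattice is free of rank 2
over `ℤ_ℓ[T]`. -/
theorem exists_free_pair_of_selfDual {ℓ : ℕ} [Fact ℓ.Prime] {V : Type*} [AddCommGroup V]
    [Module ℚ_[ℓ] V] [Module ℤ_[ℓ] V] [IsScalarTower ℤ_[ℓ] ℚ_[ℓ] V]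
    (h4 : Module.finrank ℚ_[ℓ] V = 4)
    (B : V →ₗ[ℚ_[ℓ]] V →ₗ[ℚ_[ℓ]] ℚ_[ℓ]) (halt : ∀ v, B v v = 0)
    (Λ : Submodule ℤ_[ℓ] V)
    (hsd : (Λ : Set V) = {v : V | ∀ w ∈ Λ, ∃ c : ℤ_[ℓ], B v w = (c : ℚ_[ℓ])})
    (T : V →ₗ[ℚ_[ℓ]] V) (hT : ∀ u v, B (T u) v = B u (T v)) (hTΛ : ∀ v ∈ Λ, T v ∈ Λ)
    (s t : ℤ_[ℓ]) (hsq : ∀ v, T (T v) = (s : ℚ_[ℓ]) • v + (t : ℚ_[ℓ]) • T v)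
    (hns : ¬ ∃ c : ℤ_[ℓ], ∀ v ∈ Λ, ∃ y ∈ Λ, T v - c • v = (ℓ : ℤ_[ℓ]) • y) :
    ∃ v ∈ Λ, ∃ w ∈ Λ,
      (∀ u ∈ Λ, ∃ a b c d : ℤ_[ℓ], u = (a : ℚ_[ℓ]) • v + (b : ℚ_[ℓ]) • T v +
        (c : ℚ_[ℓ]) • w + (d : ℚ_[ℓ]) • T w) ∧
      LinearIndependent ℚ_[ℓ] ![v, T v, w, T w] := by
  have hsm : ∀ (c : ℤ_[ℓ]) (x : V), c • x = (c : ℚ_[ℓ]) • x := fun c x =>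
    algebra_compatible_smul ℚ_[ℓ] c x
  have hint : ∀ u ∈ Λ, ∀ w ∈ Λ, ∃ c : ℤ_[ℓ], B u w = (c : ℚ_[ℓ]) := by
    intro u hu
    rw [← SetLike.mem_coe, hsd] at hu
    exact hu
  have hskew : ∀ u v, B u v = - B v u := by
    intro u v
    have h := halt (u + v)
    simp only [map_add, LinearMap.add_apply, halt] at h
    linear_combination h
  have hiso : ∀ u, B u (T u) = 0 := by
    intro u
    have h1 := hT u u
    have h2 := hskew (T u) u
    have h3 : (2 : ℚ_[ℓ]) * B u (T u) = 0 := by linear_combination h2 - h1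
    simpa using h3
  -- a vector `v` with `v`, `T v` independent modulo `ℓ`
  obtain ⟨v, hv, hvT⟩ : ∃ v ∈ Λ, ∀ c : ℤ_[ℓ], ∀ y ∈ Λ, T v - c • v ≠ (ℓ : ℤ_[ℓ]) • y := by
    by_contra! hcon
    let f : Λ →ₗ[ℤ_[ℓ]] Λ :=
      { toFun := fun x => ⟨T x, hTΛ x x.2⟩
        map_add' := fun x y => Subtype.ext (by simp)
        map_smul' := fun c x => Subtype.ext (by simp [hsm]) }
    have hmax : (Ideal.span {(ℓ : ℤ_[ℓ])}).IsMaximal := by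
      rw [← PadicInt.maximalIdeal_eq_span_p]
      infer_instance
    obtain ⟨c, hc⟩ := exists_forall_sub_smul_of_forall_exists (ℓ : ℤ_[ℓ]) f (fun x => by
      obtain ⟨c, y, hy, h⟩ := hcon x x.2
      exact ⟨c, ⟨y, hy⟩, Subtype.ext h⟩)
    refine hns ⟨c, fun x hx => ?_⟩
    obtain ⟨y, hy⟩ := hc ⟨x, hx⟩
    exact ⟨y, y.2, congrArg Subtype.val hy⟩
  obtain ⟨w₁, hw₁, h₁⟩ := exists_pairing_eq_one_of_selfDual B Λ hsd hv (by
    rintro y hy rfl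
    refine hvT 0 (T y) (hTΛ y hy) ?_
    simp [hsm])
  obtain ⟨e, he⟩ := hint _ (hTΛ v hv) w₁ hw₁
  obtain ⟨w₂, hw₂, h₂⟩ := exists_pairing_eq_one_of_selfDual B Λ hsd
    (Λ.sub_mem (hTΛ v hv) (Λ.smul_mem e hv)) (hvT e)
  obtain ⟨g, hg⟩ := hint v hv w₂ hw₂
  have hw : w₂ - g • w₁ ∈ Λ := Λ.sub_mem hw₂ (Λ.smul_mem g hw₁)
  generalize hwdef : w₂ - g • w₁ = w at hw
  have hvw : B v w = 0 := by
    rw [← hwdef, hsm]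
    simp [hg, h₁]
  have hTvw : B (T v) w = 1 := by
    rw [← hwdef, hsm]
    simp only [hsm, map_sub, map_smul, LinearMap.sub_apply, LinearMap.smul_apply, smul_eq_mul,
      he, hg] at h₂ ⊢
    linear_combination h₂
  have hvTw : B v (T w) = 1 := by rw [← hT, hTvw]
  have hTvTw : B (T v) (T w) = t := by
    rw [← hT, hsq]
    simp [hvw, hTvw]
  have hexp : ∀ x a b c d, x = a • v + b • T v + c • w + d • T w →
      B x w = b ∧ B x (T w) = a + t * b ∧ B v x = d ∧ B (T v) x = c + t * d := by
    rintro x a b c d rfl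
    have h3 : B (T v) v = 0 := by rw [hskew, hiso, neg_zero]
    have h4 : B (T w) w = 0 := by rw [hskew, hiso, neg_zero]
    refine ⟨?_, ?_, ?_, ?_⟩ <;>
    simp [hvw, hTvw, hvTw, hTvTw, halt, hiso, h3, h4, mul_comm]
  have hli : LinearIndependent ℚ_[ℓ] ![v, T v, w, T w] := by
    rw [Fintype.linearIndependent_iff]
    intro k hk
    simp only [Fin.sum_univ_four] at hk
    obtain ⟨h1, h2, h3, h4⟩ := hexp 0 (k 0) (k 1) (k 2) (k 3) hk.symm
    simp only [map_zero, LinearMap.zero_apply] at h1 h2 h3 h4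
    rw [← h1, mul_zero, add_zero] at h2
    rw [← h3, mul_zero, add_zero] at h4
    intro i
    fin_cases i
    exacts [h2.symm, h1.symm, h4.symm, h3.symm]
  refine ⟨v, hv, w, hw, fun u hu => ?_, hli⟩
  obtain ⟨b, hb⟩ := hint u hu w hw
  obtain ⟨a, ha⟩ := hint u hu _ (hTΛ w hw)
  obtain ⟨d, hd⟩ := hint v hv u hu
  obtain ⟨c, hc⟩ := hint _ (hTΛ v hv) u hu
  have : FiniteDimensional ℚ_[ℓ] V := FiniteDimensional.of_finrank_pos (by omega)
  have htop := hli.span_eq_top_of_card_eq_finrank' (by simp [h4])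
  have hu' : u ∈ Submodule.span ℚ_[ℓ] (Set.range ![v, T v, w, T w]) := htop ▸ trivial
  obtain ⟨k, hk⟩ := (Submodule.mem_span_range_iff_exists_fun _).1 hu'
  simp only [Fin.sum_univ_four] at hk
  obtain ⟨h1, h2, h3, h4⟩ := hexp u (k 0) (k 1) (k 2) (k 3) hk.symm
  refine ⟨a - t * b, b, c - t * d, d, ?_⟩
  push_cast
  rw [← ha, ← hb, ← hc, ← hd, h1, h2, h3, h4, add_sub_cancel_right, add_sub_cancel_right]
  exact hk.symm

/-- If `O_{K₀} = ℤ[ω]`, then `R_n` consists of the `ℤ_ℓ`-combinations of `1` and `ℓⁿω`. -/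
theorem mem_realOrderLevel_iff {ℓ : ℕ} [Fact ℓ.Prime] {K₀ : Type*} [Field K₀] [NumberField K₀]
    {ω : NumberField.RingOfIntegers K₀}
    (hω : ∀ x : NumberField.RingOfIntegers K₀, ∃ a b : ℤ, x = a + b * ω) (n : ℕ)
    (x : ℚ_[ℓ] ⊗[ℚ] K₀) :
    x ∈ realOrderLevel ℓ K₀ n ↔ ∃ a b : ℤ_[ℓ], x = algebraMap ℤ_[ℓ] _ a +
      algebraMap ℤ_[ℓ] _ b * ((ℓ : ℚ_[ℓ] ⊗[ℚ] K₀) ^ n *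
        (Algebra.TensorProduct.includeRight : K₀ →ₐ[ℚ] ℚ_[ℓ] ⊗[ℚ] K₀) ω) := by
  set ι : K₀ →ₐ[ℚ] ℚ_[ℓ] ⊗[ℚ] K₀ := Algebra.TensorProduct.includeRight
  have hιω : ∀ x : NumberField.RingOfIntegers K₀, ∃ a b : ℤ_[ℓ],
      ι x = algebraMap ℤ_[ℓ] _ a + algebraMap ℤ_[ℓ] _ b * ι ω := by
    intro x
    obtain ⟨a, b, rfl⟩ := hω x
    exact ⟨a, b, by simp only [map_add, map_mul, map_intCast]⟩
  have hmax : ∀ y ∈ maxRealLocalOrder ℓ K₀, ∃ a b : ℤ_[ℓ],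
      y = algebraMap ℤ_[ℓ] _ a + algebraMap ℤ_[ℓ] _ b * ι ω := by
    intro y hy
    induction hy using Algebra.adjoin_induction with
    | mem y hy =>
      obtain ⟨x, rfl⟩ := hy
      exact hιω x
    | algebraMap r => exact ⟨r, 0, by simp⟩
    | add y z _ _ hy hz =>
      obtain ⟨a, b, rfl⟩ := hy
      obtain ⟨c, d, rfl⟩ := hz
      refine ⟨a + c, b + d, ?_⟩
      simp only [map_add]
      ring
    | mul y z _ _ hy hz =>
      obtain ⟨a, b, rfl⟩ := hy
      obtain ⟨c, d, rfl⟩ := hz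
      obtain ⟨e, f, hef⟩ := hιω (ω * ω)
      refine ⟨a * c + b * d * e, a * d + b * c + b * d * f, ?_⟩
      simp only [map_mul] at hef
      simp only [map_add, map_mul]
      linear_combination (algebraMap ℤ_[ℓ] (ℚ_[ℓ] ⊗[ℚ] K₀) b * algebraMap ℤ_[ℓ] _ d) * hef
  constructor
  · rintro ⟨c, y, hy, rfl⟩
    obtain ⟨a, b, rfl⟩ := hmax y hy
    refine ⟨c + (ℓ : ℤ_[ℓ]) ^ n * a, b, ?_⟩
    simp only [map_add, map_mul, map_pow, map_natCast]
    ring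
  · rintro ⟨a, b, rfl⟩
    refine ⟨a, algebraMap ℤ_[ℓ] _ b * ι ω, ?_, by ring⟩
    exact mul_mem (Subalgebra.algebraMap_mem _ b) (Algebra.subset_adjoin ⟨ω, rfl⟩)

/-- Let `ℓ` be a prime, `K₀` a real quadratic number field, `A = K₀ ⊗_ℚ ℚ_ℓ`, and
`R_n = ℤ_ℓ + ℓⁿ R₀` where `R₀` is the maximal order of `A`.  Let `V` be a 4-dimensional
symplectic `ℚ_ℓ`-vector space with an `A`-module structure for which the `A`-action is
self-adjoint, and let `Λ` be a self-dual full `ℤ_ℓ`-lattice in `V` whose real order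
`{x ∈ A : xΛ ⊆ Λ}` equals `R_n`.  Then `Λ` is a free `R_n`-module of rank 2: there are
`e₁, e₂ ∈ Λ` such that every `u ∈ Λ` is uniquely `x • e₁ + y • e₂` with `x, y ∈ R_n`. -/
theorem selfdual_lattice_free_rank_two_over_real_order (ℓ : ℕ) [Fact ℓ.Prime]
    (K₀ : Type*) [Field K₀] [NumberField K₀]
    (hdeg : Module.finrank ℚ K₀ = 2)
    (hreal : ∀ φ : K₀ →+* ℂ, ∀ x : K₀, (φ x).im = 0)
    (V : Type*) [AddCommGroup V] [Module ℚ_[ℓ] V]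
    [Module ℤ_[ℓ] V] [IsScalarTower ℤ_[ℓ] ℚ_[ℓ] V]
    [Module (ℚ_[ℓ] ⊗[ℚ] K₀) V] [IsScalarTower ℚ_[ℓ] (ℚ_[ℓ] ⊗[ℚ] K₀) V]
    (h4 : Module.finrank ℚ_[ℓ] V = 4)
    (B : V →ₗ[ℚ_[ℓ]] V →ₗ[ℚ_[ℓ]] ℚ_[ℓ])
    (halt : ∀ v, B v v = 0)
    (hnd : ∀ v, (∀ w, B v w = 0) → v = 0)
    (hadj : ∀ (x : ℚ_[ℓ] ⊗[ℚ] K₀) (u v : V), B (x • u) v = B u (x • v))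
    (Λ : Submodule ℤ_[ℓ] V) (hfg : Λ.FG)
    (hfull : Submodule.span ℚ_[ℓ] (Λ : Set V) = ⊤)
    (hsd : (Λ : Set V) = {v : V | ∀ w ∈ Λ, ∃ c : ℤ_[ℓ], B v w = (c : ℚ_[ℓ])})
    (n : ℕ)
    (hord : {x : ℚ_[ℓ] ⊗[ℚ] K₀ | ∀ v ∈ Λ, x • v ∈ Λ} = realOrderLevel ℓ K₀ n) :
    ∃ e₁ e₂ : V, e₁ ∈ Λ ∧ e₂ ∈ Λ ∧ ∀ u ∈ Λ,
      ∃! p : (ℚ_[ℓ] ⊗[ℚ] K₀) × (ℚ_[ℓ] ⊗[ℚ] K₀),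
        p.1 ∈ realOrderLevel ℓ K₀ n ∧ p.2 ∈ realOrderLevel ℓ K₀ n ∧
          u = p.1 • e₁ + p.2 • e₂ := by
  obtain ⟨ω, hω, hωli⟩ := exists_monogenic_ringOfIntegers K₀ hdeg
  have hmem := mem_realOrderLevel_iff (ℓ := ℓ) hω n
  have hℓ : (ℓ : ℚ_[ℓ]) ≠ 0 := by exact_mod_cast (Fact.out : ℓ.Prime).ne_zero
  set θ : ℚ_[ℓ] ⊗[ℚ] K₀ := (ℓ : ℚ_[ℓ] ⊗[ℚ] K₀) ^ n *
    (Algebra.TensorProduct.includeRight : K₀ →ₐ[ℚ] ℚ_[ℓ] ⊗[ℚ] K₀) ω with hθ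
  have hli : ∀ α β : ℚ_[ℓ], algebraMap ℚ_[ℓ] (ℚ_[ℓ] ⊗[ℚ] K₀) α + algebraMap _ _ β * θ = 0 →
      β = 0 := by
    intro α β h
    let b := Algebra.TensorProduct.basis ℚ_[ℓ]
      (basisOfLinearIndependentOfCardEqFinrank hωli (by simp [hdeg]))
    have hpow : (ℓ : ℚ_[ℓ] ⊗[ℚ] K₀) ^ n = algebraMap ℚ_[ℓ] _ ((ℓ : ℚ_[ℓ]) ^ n) := by
      rw [map_pow, map_natCast]
    have hb := Fintype.linearIndependent_iff.1 b.linearIndependent ![α, β * ℓ ^ n] (by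
      rw [← h, hθ, hpow, Fin.sum_univ_two, ← mul_assoc, ← map_mul, ← Algebra.smul_def,
        Algebra.algebraMap_eq_smul_one]
      simp [b, Algebra.TensorProduct.basis_apply, Algebra.TensorProduct.one_def,
        TensorProduct.smul_tmul']) 1
    simpa [hℓ] using hb
  have hst : ∀ x, (∀ v ∈ Λ, x • v ∈ Λ) ↔ x ∈ realOrderLevel ℓ K₀ n := fun x => by
    rw [← hord, Set.mem_ofPred_eq]
  have hal : ∀ a : ℤ_[ℓ], algebraMap ℤ_[ℓ] (ℚ_[ℓ] ⊗[ℚ] K₀) a =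
      algebraMap ℚ_[ℓ] _ (a : ℚ_[ℓ]) := fun a =>
    IsScalarTower.algebraMap_apply ℤ_[ℓ] ℚ_[ℓ] (ℚ_[ℓ] ⊗[ℚ] K₀) a
  have hsm : ∀ (c : ℤ_[ℓ]) (x : V), c • x = (c : ℚ_[ℓ]) • x := fun c x =>
    algebra_compatible_smul ℚ_[ℓ] c x
  have hcs : ∀ (c : ℚ_[ℓ]) (x : V), algebraMap ℚ_[ℓ] (ℚ_[ℓ] ⊗[ℚ] K₀) c • x = c • x :=
    fun c x => algebraMap_smul _ c x
  have hθΛ : ∀ v ∈ Λ, θ • v ∈ Λ := (hst θ).2 ((hmem θ).2 ⟨0, 1, by rw [map_zero, map_one, zero_add, one_mul]⟩)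
  obtain ⟨s, t, hsq⟩ := (hmem (θ * θ)).1 ((hst _).1 fun v hv => by
    rw [mul_smul]
    exact hθΛ _ (hθΛ v hv))
  rw [hal, hal] at hsq
  let T : V →ₗ[ℚ_[ℓ]] V :=
    { toFun := fun v => θ • v
      map_add' := smul_add θ
      map_smul' := fun c v => by
        rw [RingHom.id_apply, ← hcs, ← hcs, smul_smul, smul_smul, mul_comm] }
  have hTθ : ∀ v, T v = θ • v := fun _ => rfl
  have hcomb : ∀ (a b : ℤ_[ℓ]) (v : V),
      (algebraMap ℤ_[ℓ] (ℚ_[ℓ] ⊗[ℚ] K₀) a + algebraMap ℤ_[ℓ] _ b * θ) • v =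
        (a : ℚ_[ℓ]) • v + (b : ℚ_[ℓ]) • T v := fun a b v => by
    rw [hal, hal, add_smul, mul_smul, hcs, hcs, hTθ]
  obtain ⟨v, hv, w, hw, hgen, hind⟩ := exists_free_pair_of_selfDual h4 B halt Λ hsd T
    (hadj θ) hθΛ s t (fun v => by
      rw [hTθ, hTθ, smul_smul, hsq, add_smul, mul_smul, hcs, hcs]) (by
    rintro ⟨c, hc⟩
    obtain ⟨a, b, hab⟩ := (hmem (algebraMap ℚ_[ℓ] _ (ℓ : ℚ_[ℓ])⁻¹ *
      (θ - algebraMap ℤ_[ℓ] _ c))).1 ((hst _).1 fun v hv => by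
        obtain ⟨y, hy, hvy⟩ := hc v hv
        rw [mul_smul, hcs, sub_smul, hal, hcs, ← hTθ, ← hsm, hvy, hsm, PadicInt.coe_natCast,
          inv_smul_smul₀ hℓ]
        exact hy)
    have hb := hli (a + (ℓ : ℚ_[ℓ])⁻¹ * c) (b - (ℓ : ℚ_[ℓ])⁻¹) (by
      rw [hal, hal, hal] at hab
      simp only [map_add, map_sub, map_mul]
      linear_combination -hab)
    have hb' : (ℓ : ℤ_[ℓ]) * b = 1 := by
      apply PadicInt.ext
      rw [PadicInt.coe_mul, sub_eq_zero.1 hb, PadicInt.coe_natCast, mul_inv_cancel₀ hℓ,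
        PadicInt.coe_one]
    exact PadicInt.prime_p.not_isUnit (IsUnit.of_mul_eq_one _ hb'))
  refine ⟨v, w, hv, hw, fun u hu => ?_⟩
  obtain ⟨a, b, c, d, rfl⟩ := hgen u hu
  refine ⟨(algebraMap ℤ_[ℓ] _ a + algebraMap ℤ_[ℓ] _ b * θ,
    algebraMap ℤ_[ℓ] _ c + algebraMap ℤ_[ℓ] _ d * θ),
    ⟨(hmem _).2 ⟨a, b, rfl⟩, (hmem _).2 ⟨c, d, rfl⟩, ?_⟩, ?_⟩
  · rw [hcomb, hcomb]
    abel
  · rintro ⟨p, q⟩ ⟨hp, hq, h⟩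
    obtain ⟨a', b', rfl⟩ := (hmem p).1 hp
    obtain ⟨c', d', rfl⟩ := (hmem q).1 hq
    rw [hcomb, hcomb] at h
    have hk := Fintype.linearIndependent_iff.1 hind
      ![(a' : ℚ_[ℓ]) - a, b' - b, c' - c, d' - d] (by
        simp only [Fin.sum_univ_four, Matrix.cons_val, sub_smul]
        linear_combination (norm := module) -h)
    obtain rfl : a' = a := PadicInt.ext (sub_eq_zero.1 (hk 0))
    obtain rfl : b' = b := PadicInt.ext (sub_eq_zero.1 (hk 1))
    obtain rfl : c' = c := PadicInt.ext (sub_eq_zero.1 (hk 2))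
    obtain rfl : d' = d := PadicInt.ext (sub_eq_zero.1 (hk 3))
    rfl
end

section
/- Let ℓ be a prime and K₀ a real quadratic number field. Set A = K₀ ⊗_ℚ ℚ_ℓ, let R₀ be the ℤ_ℓ-subalgebra of A generated by the image of O_{K₀}, and for n ≥ 0 let R_n = ℤ_ℓ + ℓⁿR₀. Let V be a 4-dimensional ℚ_ℓ-vector space with a symplectic form B, equipped with an A-module structure extending its ℚ_ℓ-vector space structure and satisfying B(x·u, v) = B(u, x·v) for all x ∈ A and u, v ∈ V. Let Λ be a self-dual full ℤ_ℓ-lattice in V whose real order {x ∈ A : x·Λ ⊆ Λ} equals R_n, with n > 0. Call a lattice Γ with ℓΛ ⊆ Γ ⊆ Λ an (ℓ,ℓ)-neighbor of Λ if its image Γ/ℓΛ is a maximal isotropic subspace of the symplectic 𝔽_ℓ-space Λ/ℓΛ. Then, among the (ℓ,ℓ)-neighbors of Λ: exactly one has real order R_{n−1}, namely the lattice ℓ·R_{n−1}·Λ (the ℤ_ℓ-span of elements ℓxλ with x ∈ R_{n−1}, λ ∈ Λ); exactly ℓ² + ℓ have real order R_n; and exactly ℓ³ have real order R_{n+1}.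 -/
open scoped TensorProduct

/-- The lattice `ℓΛ`. -/
noncomputable def ellLat (ℓ : ℕ) [Fact ℓ.Prime] (V : Type*) [AddCommGroup V]
    [Module ℤ_[ℓ] V] (Λ : Submodule ℤ_[ℓ] V) : Submodule ℤ_[ℓ] V :=
  Submodule.map (LinearMap.lsmul ℤ_[ℓ] V (ℓ : ℤ_[ℓ])) Λ

/-- `Γ` is an `(ℓ,ℓ)`-neighbor of the self-dual lattice `Λ`: `ℓΛ ⊆ Γ ⊆ Λ` and `Γ/ℓΛ` is a
maximal isotropic (= 2-dimensional isotropic) subspace of the symplectic `𝔽_ℓ`-space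
`Λ/ℓΛ`. -/
def IsEllEllNeighbor (ℓ : ℕ) [Fact ℓ.Prime] (V : Type*) [AddCommGroup V] [Module ℚ_[ℓ] V]
    [Module ℤ_[ℓ] V] (B : V →ₗ[ℚ_[ℓ]] V →ₗ[ℚ_[ℓ]] ℚ_[ℓ])
    (Λ Γ : Submodule ℤ_[ℓ] V) : Prop :=
  ellLat ℓ V Λ ≤ Γ ∧ Γ ≤ Λ ∧
    (∀ x ∈ Γ, ∀ y ∈ Γ, ∃ c : ℤ_[ℓ], B x y = (ℓ : ℚ_[ℓ]) * (c : ℚ_[ℓ])) ∧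
    Nat.card (Γ ⧸ Submodule.comap Γ.subtype (ellLat ℓ V Λ)) = ℓ ^ 2


/-- The ring of integers of a quadratic field is generated by one element over `ℤ`. -/
theorem exists_ringOfIntegers_generator (K₀ : Type*) [Field K₀] [NumberField K₀]
    (hdeg : Module.finrank ℚ K₀ = 2) :
    ∃ ω : NumberField.RingOfIntegers K₀, ∀ a : NumberField.RingOfIntegers K₀,
      ∃ m n : ℤ, a = m + n * ω := by
  have hrk : Module.finrank ℤ (NumberField.RingOfIntegers K₀) = 2 :=
    (NumberField.RingOfIntegers.rank K₀).trans hdeg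
  let b := Module.finBasisOfFinrankEq ℤ (NumberField.RingOfIntegers K₀) hrk
  have hsum : ∀ a, a = (b.repr a 0 : NumberField.RingOfIntegers K₀) * b 0
      + (b.repr a 1 : NumberField.RingOfIntegers K₀) * b 1 := fun a => by
    conv_lhs => rw [← b.sum_repr a]
    simp [Fin.sum_univ_two]
  set p := b.repr 1 0 with hp
  set q := b.repr 1 1 with hq
  have hone : (1 : NumberField.RingOfIntegers K₀) = p * b 0 + q * b 1 := hsum 1
  have hcop : IsCoprime p q := by
    rw [Int.isCoprime_iff_gcd_eq_one]
    obtain ⟨p', hp'⟩ := Int.gcd_dvd_left (a := p) (b := q)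
    obtain ⟨q', hq'⟩ := Int.gcd_dvd_right (a := p) (b := q)
    generalize p.gcd q = g at hp' hq'
    have hb : b 0 = (g : ℤ) • ((p' * b 0 + q' * b 1) * b 0) := by
      conv_lhs => rw [← one_mul (b 0), hone, hp', hq']
      push_cast
      simp only [zsmul_eq_mul]
      push_cast
      ring
    have hc := congrArg (fun a => b.repr a 0) hb
    simp only [map_zsmul, Finsupp.smul_apply, Module.Basis.repr_self, Finsupp.single_eq_same,
      smul_eq_mul] at hc
    have hu : IsUnit (g : ℤ) := IsUnit.of_mul_eq_one _ hc.symm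
    simpa using Int.isUnit_iff_natAbs_eq.mp hu
  obtain ⟨r, s, hrs⟩ := hcop
  have hrs' : (r : NumberField.RingOfIntegers K₀) * p + s * q = 1 := by exact_mod_cast hrs
  refine ⟨r * b 1 - s * b 0, fun a => ⟨b.repr a 0 * r + b.repr a 1 * s,
    b.repr a 1 * p - b.repr a 0 * q, ?_⟩⟩
  conv_lhs => rw [hsum a]
  push_cast
  linear_combination
    (-(b.repr a 0 : NumberField.RingOfIntegers K₀) * b 0 - b.repr a 1 * b 1) * hrs'
    - ((b.repr a 0 : NumberField.RingOfIntegers K₀) * r + b.repr a 1 * s) * hone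

/-- The maximal real order of a quadratic field at `ℓ` has the form `ℤ_ℓ + ℤ_ℓ ω`, where `ω` is
not a scalar. -/
theorem exists_maxRealLocalOrder_generator (ℓ : ℕ) [Fact ℓ.Prime] (K₀ : Type*) [Field K₀]
    [NumberField K₀] (hdeg : Module.finrank ℚ K₀ = 2) :
    ∃ ω ∈ maxRealLocalOrder ℓ K₀,
      (∀ y ∈ maxRealLocalOrder ℓ K₀, ∃ c d : ℤ_[ℓ],
        y = algebraMap ℤ_[ℓ] (ℚ_[ℓ] ⊗[ℚ] K₀) c + algebraMap ℤ_[ℓ] (ℚ_[ℓ] ⊗[ℚ] K₀) d * ω) ∧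
      ∀ q : ℚ_[ℓ], ω ≠ algebraMap ℚ_[ℓ] (ℚ_[ℓ] ⊗[ℚ] K₀) q := by
  obtain ⟨ω₀, hω₀⟩ := exists_ringOfIntegers_generator K₀ hdeg
  let ι : NumberField.RingOfIntegers K₀ →+* ℚ_[ℓ] ⊗[ℚ] K₀ :=
    ((Algebra.TensorProduct.includeRight : K₀ →ₐ[ℚ] ℚ_[ℓ] ⊗[ℚ] K₀) : K₀ →+* ℚ_[ℓ] ⊗[ℚ] K₀).comp
      (algebraMap (NumberField.RingOfIntegers K₀) K₀)
  have hι : ∀ a, ∃ m n : ℤ, ι a = algebraMap ℤ_[ℓ] (ℚ_[ℓ] ⊗[ℚ] K₀) m +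
      algebraMap ℤ_[ℓ] (ℚ_[ℓ] ⊗[ℚ] K₀) n * ι ω₀ := fun a => by
    obtain ⟨m, n, h⟩ := hω₀ a
    refine ⟨m, n, ?_⟩
    rw [h]
    simp
  have hspan : ∀ y ∈ maxRealLocalOrder ℓ K₀, ∃ c d : ℤ_[ℓ],
      y = algebraMap ℤ_[ℓ] (ℚ_[ℓ] ⊗[ℚ] K₀) c +
        algebraMap ℤ_[ℓ] (ℚ_[ℓ] ⊗[ℚ] K₀) d * ι ω₀ := by
    intro y hy
    induction hy using Algebra.adjoin_induction with
    | mem x hx =>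
      obtain ⟨a, rfl⟩ := hx
      obtain ⟨m, n, h⟩ := hι a
      exact ⟨m, n, h⟩
    | algebraMap r => exact ⟨r, 0, by simp⟩
    | add x y _ _ hx hy =>
      obtain ⟨c, d, rfl⟩ := hx
      obtain ⟨c', d', rfl⟩ := hy
      exact ⟨c + c', d + d', by simp only [map_add]; ring⟩
    | mul x y _ _ hx hy =>
      obtain ⟨c, d, rfl⟩ := hx
      obtain ⟨c', d', rfl⟩ := hy
      obtain ⟨m, n, h⟩ := hι (ω₀ * ω₀)
      rw [map_mul] at h
      refine ⟨c * c' + d * d' * m, c * d' + c' * d + d * d' * n, ?_⟩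
      simp only [map_add, map_mul]
      linear_combination (algebraMap ℤ_[ℓ] (ℚ_[ℓ] ⊗[ℚ] K₀) d *
        algebraMap ℤ_[ℓ] (ℚ_[ℓ] ⊗[ℚ] K₀) d') * h
  refine ⟨ι ω₀, Algebra.subset_adjoin ⟨ω₀, rfl⟩, hspan, fun q hq => ?_⟩
  have hfin : Module.finrank ℚ_[ℓ] (ℚ_[ℓ] ⊗[ℚ] K₀) = 2 := by
    rw [Module.finrank_baseChange, hdeg]
  have hscalar : ∀ k : K₀, ∃ r : ℚ_[ℓ], (1 : ℚ_[ℓ]) ⊗ₜ[ℚ] k = r ⊗ₜ[ℚ] (1 : K₀) := by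
    intro k
    obtain ⟨y, hy, hint⟩ := ((IsFractionRing.isAlgebraic_iff ℤ ℚ K₀).2
      (Algebra.IsAlgebraic.isAlgebraic (R := ℚ) k)).exists_integral_multiple
    obtain ⟨m, n, h⟩ := hι ⟨y • k, hint⟩
    have h' : (1 : ℚ_[ℓ]) ⊗ₜ[ℚ] (y • k) = (m + n * q : ℚ_[ℓ]) ⊗ₜ[ℚ] (1 : K₀) := by
      rw [hq] at h
      refine h.trans ?_
      change _ = algebraMap ℚ_[ℓ] (ℚ_[ℓ] ⊗[ℚ] K₀) (m + n * q)
      simp only [map_add, map_mul, map_intCast]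
    refine ⟨(y : ℚ_[ℓ])⁻¹ * (m + n * q), ?_⟩
    have hy' : (y : ℚ_[ℓ]) ≠ 0 := Int.cast_ne_zero.2 hy
    rw [← smul_eq_mul, ← TensorProduct.smul_tmul', ← h', TensorProduct.tmul_smul,
      ← Int.cast_smul_eq_zsmul ℚ_[ℓ], inv_smul_smul₀ hy']
  have hle : Module.finrank ℚ_[ℓ] (ℚ_[ℓ] ⊗[ℚ] K₀) ≤ 1 := by
    refine finrank_le_one (1 : ℚ_[ℓ] ⊗[ℚ] K₀) fun w => ?_
    induction w using TensorProduct.induction_on with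
    | zero => exact ⟨0, zero_smul _ _⟩
    | tmul a k =>
      obtain ⟨r, hr⟩ := hscalar k
      refine ⟨a * r, ?_⟩
      have := congrArg (fun z => a • z) hr
      simp only [TensorProduct.smul_tmul', smul_eq_mul, mul_one] at this
      rw [this, Algebra.TensorProduct.one_def, TensorProduct.smul_tmul', smul_eq_mul, mul_one]
    | add x y hx hy =>
      obtain ⟨c, hc⟩ := hx
      obtain ⟨d, hd⟩ := hy
      exact ⟨c + d, by rw [add_smul, hc, hd]⟩
  omega

section Planes

/-- The standard symplectic form on `R⁴` for which the square-zero operator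
`(a, b, c, d) ↦ (0, 0, a, b)` is self-adjoint. -/
def sympForm {R : Type*} [CommRing R] (x y : R × R × R × R) : R :=
  x.1 * y.2.2.2 - x.2.2.2 * y.1 + x.2.2.1 * y.2.1 - x.2.1 * y.2.2.1

variable {F : Type*} [Field F]

/-- The square-zero operator `(a, b, c, d) ↦ (0, 0, a, b)` on `F⁴`. -/
def shift (x : F × F × F × F) : F × F × F × F := (0, 0, x.1, x.2.1)

/-- Isotropic planes in `F⁴`. -/
def IsLagrangian (L : Submodule F (F × F × F × F)) : Prop :=
  (∀ x ∈ L, ∀ y ∈ L, sympForm x y = 0) ∧ Nat.card L = Nat.card F ^ 2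

/-- The Lagrangian complement of the kernel of `shift` with parameters `a, b, c`. -/
def graphPlane (p : F × F × F) : Submodule F (F × F × F × F) where
  carrier := {x | x.2.2.1 = p.1 * x.1 + p.2.2 * x.2.1 ∧ x.2.2.2 = p.2.1 * x.1 - p.1 * x.2.1}
  zero_mem' := by simp
  add_mem' := by
    rintro x y ⟨h1, h2⟩ ⟨h3, h4⟩
    constructor <;> simp only [Prod.fst_add, Prod.snd_add, h1, h2, h3, h4] <;> ring
  smul_mem' := by
    rintro r x ⟨h1, h2⟩
    constructor <;> simp only [Prod.smul_fst, Prod.smul_snd, smul_eq_mul, h1, h2] <;> ring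

/-- The `shift`-stable Lagrangian planes other than the kernel of `shift`. -/
def stablePlane : (F × F) ⊕ F → Submodule F (F × F × F × F)
  | .inl p =>
    { carrier := {x | x.2.1 = p.1 * x.1 ∧ x.2.2.2 = p.2 * x.1 + p.1 * x.2.2.1}
      zero_mem' := by simp
      add_mem' := by
        rintro x y ⟨h1, h2⟩ ⟨h3, h4⟩
        constructor <;> simp only [Prod.fst_add, Prod.snd_add, h1, h2, h3, h4] <;> ring
      smul_mem' := by
        rintro r x ⟨h1, h2⟩
        constructor <;> simp only [Prod.smul_fst, Prod.smul_snd, smul_eq_mul, h1, h2] <;> ring }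
  | .inr a =>
    { carrier := {x | x.1 = 0 ∧ x.2.2.1 = a * x.2.1}
      zero_mem' := by simp
      add_mem' := by
        rintro x y ⟨h1, h2⟩ ⟨h3, h4⟩
        constructor <;> simp only [Prod.fst_add, Prod.snd_add, h1, h2, h3, h4] <;> ring
      smul_mem' := by
        rintro r x ⟨h1, h2⟩
        constructor <;> simp only [Prod.smul_fst, Prod.smul_snd, smul_eq_mul, h1, h2] <;> ring }

theorem mem_graphPlane {p : F × F × F} {x : F × F × F × F} : x ∈ graphPlane p ↔
    x.2.2.1 = p.1 * x.1 + p.2.2 * x.2.1 ∧ x.2.2.2 = p.2.1 * x.1 - p.1 * x.2.1 := Iff.rfl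

theorem mem_stablePlane_inl {p : F × F} {x : F × F × F × F} : x ∈ stablePlane (.inl p) ↔
    x.2.1 = p.1 * x.1 ∧ x.2.2.2 = p.2 * x.1 + p.1 * x.2.2.1 := Iff.rfl

theorem mem_stablePlane_inr {a : F} {x : F × F × F × F} : x ∈ stablePlane (.inr a) ↔
    x.1 = 0 ∧ x.2.2.1 = a * x.2.1 := Iff.rfl

theorem graphPlane_injective : Function.Injective (graphPlane (F := F)) := by
  rintro ⟨a, b, c⟩ ⟨a', b', c'⟩ h
  have h1 : ((1, 0, a, b) : F × F × F × F) ∈ graphPlane (a', b', c') := by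
    rw [← h]; simp [mem_graphPlane]
  have h2 : ((0, 1, c, -a) : F × F × F × F) ∈ graphPlane (a', b', c') := by
    rw [← h]; simp [mem_graphPlane]
  simp only [mem_graphPlane] at h1 h2
  simp at h1 h2
  simp [h1, h2]

theorem stablePlane_injective : Function.Injective (stablePlane (F := F)) := by
  rintro (⟨s, b⟩ | a) (⟨s', b'⟩ | a') h
  · have h1 : ((1, s, 0, b) : F × F × F × F) ∈ stablePlane (.inl (s', b')) := by
      rw [← h]; simp [mem_stablePlane_inl]
    simp only [mem_stablePlane_inl] at h1
    simp at h1
    simp [h1]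
  · have h1 : ((1, s, 0, b) : F × F × F × F) ∈ stablePlane (.inr a') := by
      rw [← h]; simp [mem_stablePlane_inl]
    simp [mem_stablePlane_inr] at h1
  · have h1 : ((1, s', 0, b') : F × F × F × F) ∈ stablePlane (.inr a) := by
      rw [h]; simp [mem_stablePlane_inl]
    simp [mem_stablePlane_inr] at h1
  · have h1 : ((0, 1, a, 0) : F × F × F × F) ∈ stablePlane (.inr a') := by
      rw [← h]; simp [mem_stablePlane_inr]
    simp [mem_stablePlane_inr] at h1
    simp [h1]

theorem isLagrangian_graphPlane (p : F × F × F) : IsLagrangian (graphPlane p) := by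
  refine ⟨fun x hx y hy => ?_, ?_⟩
  · rw [mem_graphPlane] at hx hy
    simp only [sympForm, hx.1, hx.2, hy.1, hy.2]
    ring
  · rw [sq, ← Nat.card_prod]
    refine Nat.card_eq_of_bijective (fun x : graphPlane p => (x.1.1, x.1.2.1)) ⟨?_, ?_⟩
    · rintro ⟨⟨x1, x2, x3, x4⟩, hx⟩ ⟨⟨y1, y2, y3, y4⟩, hy⟩ h
      simp only [mem_graphPlane] at hx hy
      simp only [Prod.mk.injEq] at h
      simp [h, hx, hy]
    · rintro ⟨x1, x2⟩
      exact ⟨⟨(x1, x2, p.1 * x1 + p.2.2 * x2, p.2.1 * x1 - p.1 * x2), rfl, rfl⟩, rfl⟩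

theorem isLagrangian_stablePlane (p : (F × F) ⊕ F) : IsLagrangian (stablePlane p) := by
  rcases p with ⟨s, b⟩ | a
  · refine ⟨fun x hx y hy => ?_, ?_⟩
    · rw [mem_stablePlane_inl] at hx hy
      simp only [sympForm, hx.1, hx.2, hy.1, hy.2]
      ring
    · rw [sq, ← Nat.card_prod]
      refine Nat.card_eq_of_bijective
        (fun x : stablePlane (.inl (s, b)) => (x.1.1, x.1.2.2.1)) ⟨?_, ?_⟩
      · rintro ⟨⟨x1, x2, x3, x4⟩, hx⟩ ⟨⟨y1, y2, y3, y4⟩, hy⟩ h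
        simp only [mem_stablePlane_inl] at hx hy
        simp only [Prod.mk.injEq] at h
        simp [h, hx, hy]
      · rintro ⟨x1, x3⟩
        exact ⟨⟨(x1, s * x1, x3, b * x1 + s * x3), rfl, rfl⟩, rfl⟩
  · refine ⟨fun x hx y hy => ?_, ?_⟩
    · rw [mem_stablePlane_inr] at hx hy
      simp only [sympForm, hx.1, hx.2, hy.1, hy.2]
      ring
    · rw [sq, ← Nat.card_prod]
      refine Nat.card_eq_of_bijective
        (fun x : stablePlane (.inr a) => (x.1.2.1, x.1.2.2.2)) ⟨?_, ?_⟩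
      · rintro ⟨⟨x1, x2, x3, x4⟩, hx⟩ ⟨⟨y1, y2, y3, y4⟩, hy⟩ h
        simp only [mem_stablePlane_inr] at hx hy
        simp only [Prod.mk.injEq] at h
        simp [h, hx, hy]
      · rintro ⟨x2, x4⟩
        exact ⟨⟨(0, x2, a * x2, x4), rfl, rfl⟩, rfl⟩

/-- The kernel of `shift`. -/
def shiftKer (F : Type*) [Field F] : Submodule F (F × F × F × F) where
  carrier := {x | x.1 = 0 ∧ x.2.1 = 0}
  zero_mem' := by simp
  add_mem' := by
    rintro x y ⟨h1, h2⟩ ⟨h3, h4⟩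
    constructor <;> simp [h1, h2, h3, h4]
  smul_mem' := by
    rintro r x ⟨h1, h2⟩
    constructor <;> simp [h1, h2]

theorem mem_shiftKer {x : F × F × F × F} : x ∈ shiftKer F ↔ x.1 = 0 ∧ x.2.1 = 0 := Iff.rfl

theorem shift_eq_zero_iff {x : F × F × F × F} : shift x = 0 ↔ x ∈ shiftKer F := by
  simp [shift, mem_shiftKer, Prod.ext_iff]

theorem isLagrangian_shiftKer : IsLagrangian (shiftKer F) := by
  refine ⟨fun x hx y hy => ?_, ?_⟩
  · rw [mem_shiftKer] at hx hy
    simp [sympForm, hx.1, hx.2, hy.1, hy.2]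
  · rw [sq, ← Nat.card_prod]
    refine Nat.card_eq_of_bijective (fun x : shiftKer F => x.1.2.2) ⟨?_, ?_⟩
    · rintro ⟨⟨x1, x2, x3, x4⟩, hx⟩ ⟨⟨y1, y2, y3, y4⟩, hy⟩ h
      simp only [mem_shiftKer] at hx hy
      simp only [Prod.mk.injEq] at h
      simp [h, hx, hy]
    · rintro ⟨x3, x4⟩
      exact ⟨⟨(0, 0, x3, x4), rfl, rfl⟩, rfl⟩

/-- A Lagrangian plane meeting the kernel of `shift` nontrivially is stable under `shift`. -/
theorem IsLagrangian.shift_mem_of_mem_shiftKer {L : Submodule F (F × F × F × F)}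
    (hL : IsLagrangian L) {k : F × F × F × F} (hkL : k ∈ L) (hk : k ∈ shiftKer F) (hk0 : k ≠ 0) :
    ∀ x ∈ L, shift x ∈ L := by
  intro x hx
  obtain ⟨k1, k2, k3, k4⟩ := k
  obtain ⟨rfl, rfl⟩ : k1 = 0 ∧ k2 = 0 := mem_shiftKer.1 hk
  have h := hL.1 _ hkL x hx
  simp only [sympForm] at h
  by_cases h3 : k3 = 0
  · have h4 : k4 ≠ 0 := by
      rintro rfl
      simp [h3] at hk0
    subst h3
    have hx1 : x.1 = 0 := by simpa [h4] using h
    have : shift x = (x.2.1 * k4⁻¹) • ((0, 0, 0, k4) : F × F × F × F) := by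
      simp [shift, hx1, h4]
    rw [this]
    exact L.smul_mem _ hkL
  · have : shift x = (x.1 * k3⁻¹) • ((0, 0, k3, k4) : F × F × F × F) := by
      simp only [shift, Prod.smul_mk, smul_eq_mul, mul_zero, Prod.mk.injEq, true_and]
      constructor
      · field_simp
      · field_simp
        linear_combination h
    rw [this]
    exact L.smul_mem _ hkL

variable [Finite F]

theorem IsLagrangian.eq_of_le {L M : Submodule F (F × F × F × F)} (hL : IsLagrangian L)
    (hM : IsLagrangian M) (h : L ≤ M) : L = M := by
  refine SetLike.coe_injective (Set.eq_of_subset_of_ncard_le h ?_ (Set.toFinite _))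
  exact (hM.2.trans hL.2.symm).le

theorem IsLagrangian.shift_eq_zero_iff {L : Submodule F (F × F × F × F)} (hL : IsLagrangian L) :
    (∀ x ∈ L, shift x = 0) ↔ L = shiftKer F := by
  refine ⟨fun h => hL.eq_of_le isLagrangian_shiftKer fun x hx =>
    _root_.shift_eq_zero_iff.1 (h x hx), ?_⟩
  rintro rfl x hx
  exact _root_.shift_eq_zero_iff.2 hx

theorem IsLagrangian.not_shift_mem_iff {L : Submodule F (F × F × F × F)} :
    (IsLagrangian L ∧ ¬ ∀ x ∈ L, shift x ∈ L) ↔ L ∈ Set.range (graphPlane (F := F)) := by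
  constructor
  · rintro ⟨hL, hns⟩
    have hdisj : ∀ k ∈ L, k.1 = 0 → k.2.1 = 0 → k = 0 := fun k hk h1 h2 => by
      by_contra h0
      exact hns (hL.shift_mem_of_mem_shiftKer hk ⟨h1, h2⟩ h0)
    have hinj : Function.Injective (fun x : L => (x.1.1, x.1.2.1)) := by
      rintro ⟨x, hx⟩ ⟨y, hy⟩ h
      simp only [Prod.mk.injEq] at h
      refine Subtype.ext (sub_eq_zero.1 (hdisj _ (L.sub_mem hx hy) ?_ ?_)) <;> simp [h]
    have hbij : Function.Bijective (fun x : L => (x.1.1, x.1.2.1)) := by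
      rw [Nat.bijective_iff_injective_and_card]
      exact ⟨hinj, by rw [hL.2, Nat.card_prod, sq]⟩
    obtain ⟨⟨⟨p1, p2, a, b⟩, hp⟩, hp'⟩ := hbij.2 (1, 0)
    obtain ⟨⟨⟨q1, q2, c, d⟩, hq⟩, hq'⟩ := hbij.2 (0, 1)
    simp only [Prod.mk.injEq] at hp' hq'
    obtain ⟨rfl, rfl⟩ := hp'
    obtain ⟨rfl, rfl⟩ := hq'
    have hd := hL.1 _ hp _ hq
    simp only [sympForm] at hd
    refine ⟨(a, b, c), ((hL.eq_of_le (isLagrangian_graphPlane _) ?_)).symm⟩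
    rintro ⟨x1, x2, x3, x4⟩ hx
    have h0 := hdisj _ (L.sub_mem hx (L.add_mem (L.smul_mem x1 hp) (L.smul_mem x2 hq)))
      (by simp) (by simp)
    simp only [Prod.smul_mk, Prod.mk_add_mk, Prod.mk_sub_mk, Prod.mk_eq_zero, smul_eq_mul] at h0
    refine mem_graphPlane.2 ⟨?_, ?_⟩ <;> simp only
    · linear_combination h0.2.2.1
    · linear_combination h0.2.2.2 + x2 * hd
  · rintro ⟨p, rfl⟩
    refine ⟨isLagrangian_graphPlane p, fun h => ?_⟩
    have h1 := h (1, 0, p.1, p.2.1) (by simp [mem_graphPlane])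
    simp [shift, mem_graphPlane] at h1

theorem IsLagrangian.shift_mem_iff {L : Submodule F (F × F × F × F)} :
    (IsLagrangian L ∧ (∀ x ∈ L, shift x ∈ L) ∧ ¬ ∀ x ∈ L, shift x = 0) ↔
      L ∈ Set.range (stablePlane (F := F)) := by
  constructor
  · rintro ⟨hL, hs, hne⟩
    push Not at hne
    obtain ⟨w, hw, hw0⟩ := hne
    by_cases h1 : w.1 = 0
    · have h2 : w.2.1 ≠ 0 := fun h2 => hw0 (_root_.shift_eq_zero_iff.2 ⟨h1, h2⟩)
      refine ⟨.inr (w.2.2.1 / w.2.1), (hL.eq_of_le (isLagrangian_stablePlane _) ?_).symm⟩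
      intro x hx
      have e1 := hL.1 _ (hs w hw) x hx
      have e2 := hL.1 _ hw x hx
      simp only [sympForm, shift, h1] at e1 e2
      have hx1 : x.1 = 0 := by simpa [h2] using e1
      refine mem_stablePlane_inr.2 ⟨hx1, ?_⟩
      rw [hx1] at e2
      field_simp
      linear_combination -e2
    · refine ⟨.inl (w.2.1 / w.1, (w.2.2.2 - w.2.1 / w.1 * w.2.2.1) / w.1),
        (hL.eq_of_le (isLagrangian_stablePlane _) ?_).symm⟩
      intro x hx
      have e1 := hL.1 _ (hs w hw) x hx
      have e2 := hL.1 _ hw x hx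
      simp only [sympForm, shift] at e1 e2
      have hx2 : x.2.1 = w.2.1 / w.1 * x.1 := by
        field_simp
        linear_combination e1
      refine mem_stablePlane_inl.2 ⟨hx2, ?_⟩
      rw [hx2] at e2
      field_simp at e2 ⊢
      linear_combination e2
  · rintro ⟨p, rfl⟩
    refine ⟨isLagrangian_stablePlane p, ?_⟩
    rcases p with ⟨s, b⟩ | a
    · refine ⟨fun x hx => ?_, fun h => ?_⟩
      · rw [mem_stablePlane_inl] at hx
        simp [shift, mem_stablePlane_inl, hx.1]
      · have h1 := h (1, s, 0, b) (by simp [mem_stablePlane_inl])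
        simp [shift] at h1
    · refine ⟨fun x hx => ?_, fun h => ?_⟩
      · rw [mem_stablePlane_inr] at hx
        simp [shift, mem_stablePlane_inr, hx.1]
      · have h1 := h (0, 1, a, 0) (by simp [mem_stablePlane_inr])
        simp [shift] at h1

theorem card_lagrangian_not_shift_stable :
    Nat.card {L : Submodule F (F × F × F × F) | IsLagrangian L ∧ ¬ ∀ x ∈ L, shift x ∈ L} =
      Nat.card F ^ 3 := by
  have : {L : Submodule F (F × F × F × F) | IsLagrangian L ∧ ¬ ∀ x ∈ L, shift x ∈ L} =
      Set.range graphPlane := Set.ext fun _ => IsLagrangian.not_shift_mem_iff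
  rw [this, Nat.card_range_of_injective graphPlane_injective]
  simp only [Nat.card_prod]
  ring

theorem card_lagrangian_shift_stable :
    Nat.card {L : Submodule F (F × F × F × F) |
      IsLagrangian L ∧ (∀ x ∈ L, shift x ∈ L) ∧ ¬ ∀ x ∈ L, shift x = 0} =
      Nat.card F ^ 2 + Nat.card F := by
  have : {L : Submodule F (F × F × F × F) |
      IsLagrangian L ∧ (∀ x ∈ L, shift x ∈ L) ∧ ¬ ∀ x ∈ L, shift x = 0} =
      Set.range stablePlane := Set.ext fun _ => IsLagrangian.shift_mem_iff
  rw [this, Nat.card_range_of_injective stablePlane_injective, Nat.card_sum, Nat.card_prod, sq]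

end Planes

section Coordinates

variable {ℓ : ℕ} [Fact ℓ.Prime]

theorem PadicInt.isUnit_of_not_dvd {a : ℤ_[ℓ]} (h : ¬ (ℓ : ℤ_[ℓ]) ∣ a) : IsUnit a := by
  rw [← PadicInt.norm_lt_one_iff_dvd, not_lt] at h
  exact PadicInt.isUnit_iff.2 (le_antisymm (PadicInt.norm_le_one a) h)

theorem PadicInt.not_dvd_one_sub_mul (a : ℤ_[ℓ]) : ¬ (ℓ : ℤ_[ℓ]) ∣ 1 - ℓ * a := fun h =>
  PadicInt.prime_p.not_dvd_one (by simpa using dvd_add h (dvd_mul_right (ℓ : ℤ_[ℓ]) a))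

theorem PadicInt.coe_smul_eq {V : Type*} [AddCommGroup V] [Module ℚ_[ℓ] V] [Module ℤ_[ℓ] V]
    [IsScalarTower ℤ_[ℓ] ℚ_[ℓ] V] (c : ℤ_[ℓ]) (v : V) : (c : ℚ_[ℓ]) • v = c • v :=
  algebraMap_smul ℚ_[ℓ] c v

variable {V : Type*} [AddCommGroup V] [Module ℚ_[ℓ] V] [Module ℤ_[ℓ] V]
  [IsScalarTower ℤ_[ℓ] ℚ_[ℓ] V]

/-- Coordinates on a lattice `Λ` in which the operator `ℓθ`, where `θ² = c + tθ`, and the form `B`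
are congruent modulo `ℓ` to `shift` and to `sympForm`. -/
structure IsAdapted (B : V →ₗ[ℚ_[ℓ]] V →ₗ[ℚ_[ℓ]] ℚ_[ℓ]) (θ : V →ₗ[ℚ_[ℓ]] V) (c t : ℤ_[ℓ])
    (Λ : Submodule ℤ_[ℓ] V) (h : (ℤ_[ℓ] × ℤ_[ℓ] × ℤ_[ℓ] × ℤ_[ℓ]) →ₗ[ℤ_[ℓ]] V) : Prop where
  injective : Function.Injective h
  mem_iff : ∀ v, v ∈ Λ ↔ ∃ x, h x = v
  smul_apply : ∀ x, (ℓ : ℚ_[ℓ]) • θ (h x) =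
    h (ℓ ^ 2 * c * x.2.2.1, ℓ ^ 2 * c * x.2.2.2, x.1 + ℓ * t * x.2.2.1, x.2.1 + ℓ * t * x.2.2.2)
  form_apply : ∀ x y, B (h x) (h y) =
    ((sympForm x y + ℓ * t * (x.2.2.1 * y.2.2.2 - x.2.2.2 * y.2.2.1) : ℤ_[ℓ]) : ℚ_[ℓ])

/-- A self-adjoint operator that carries a self-dual lattice into itself but not into `ℓΛ` admits
vectors `u₁, u₂ ∈ Λ` generating a standard symplectic basis. -/
theorem exists_hyperbolic_generators (B : V →ₗ[ℚ_[ℓ]] V →ₗ[ℚ_[ℓ]] ℚ_[ℓ])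
    (θ : V →ₗ[ℚ_[ℓ]] V) (hadj : ∀ u v, B (θ u) v = B u (θ v))
    (c t : ℤ_[ℓ]) (hθ : ∀ v, θ (θ v) = (c : ℚ_[ℓ]) • v + (t : ℚ_[ℓ]) • θ v)
    (Λ : Submodule ℤ_[ℓ] V)
    (hsd : (Λ : Set V) = {v : V | ∀ w ∈ Λ, ∃ c : ℤ_[ℓ], B v w = (c : ℚ_[ℓ])})
    (hψ : ∀ v ∈ Λ, (ℓ : ℚ_[ℓ]) • θ v ∈ Λ) (hnot : ¬ ∀ v ∈ Λ, θ v ∈ Λ) :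
    ∃ u₁ ∈ Λ, ∃ u₂ ∈ Λ, B u₁ u₂ = 0 ∧ (ℓ : ℚ_[ℓ]) * B (θ u₁) u₂ = 1 := by
  have hmem : ∀ v, v ∈ Λ ↔ ∀ w ∈ Λ, ∃ c : ℤ_[ℓ], B v w = (c : ℚ_[ℓ]) := fun v => by
    rw [← SetLike.mem_coe, hsd, Set.mem_ofPred_eq]
  have hsmul : ∀ (a : ℤ_[ℓ]) (v : V), v ∈ Λ → (a : ℚ_[ℓ]) • v ∈ Λ := fun a v hv => by
    rw [PadicInt.coe_smul_eq]
    exact Λ.smul_mem a hv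
  have hℓ : (ℓ : ℚ_[ℓ]) ≠ 0 := by exact_mod_cast (Fact.out : ℓ.Prime).ne_zero
  have hinv : ∀ a : ℤ_[ℓ], ¬ (ℓ : ℤ_[ℓ]) ∣ a → ∃ b : ℤ_[ℓ], (b : ℚ_[ℓ]) * a = 1 := fun a ha => by
    obtain ⟨b, hb⟩ := (PadicInt.isUnit_of_not_dvd ha).exists_left_inv
    exact ⟨b, by rw [← PadicInt.coe_mul, hb, PadicInt.coe_one]⟩
  push Not at hnot
  obtain ⟨u, hu, hθu⟩ := hnot
  rw [hmem] at hθu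
  push Not at hθu
  obtain ⟨w, hw, huw⟩ := hθu
  obtain ⟨ε, hε⟩ := (hmem _).1 (hψ u hu) w hw
  rw [map_smul, LinearMap.smul_apply, smul_eq_mul] at hε
  have hεdvd : ¬ (ℓ : ℤ_[ℓ]) ∣ ε := by
    rintro ⟨a, rfl⟩
    refine huw a (mul_left_cancel₀ hℓ ?_)
    rw [hε]
    push_cast
    rfl
  obtain ⟨ε', hε'⟩ := hinv ε hεdvd
  obtain ⟨w', hw', h1⟩ : ∃ w' ∈ Λ, (ℓ : ℚ_[ℓ]) * B (θ u) w' = 1 := by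
    refine ⟨_, hsmul ε' w hw, ?_⟩
    rw [map_smul, smul_eq_mul, ← hε', ← hε]
    ring
  obtain ⟨b, hb⟩ := (hmem u).1 hu _ hw'
  obtain ⟨δ, hδ⟩ := hinv _ (PadicInt.not_dvd_one_sub_mul (b * ((ℓ : ℤ_[ℓ]) * c * b + t)))
  have h2 : (ℓ : ℚ_[ℓ]) * B (θ u) (θ w') = ℓ * c * b + t := by
    rw [← hadj, hθ, map_add, LinearMap.add_apply, map_smul, map_smul, LinearMap.smul_apply,
      LinearMap.smul_apply, hb, smul_eq_mul, smul_eq_mul]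
    linear_combination (t : ℚ_[ℓ]) * h1
  refine ⟨u, hu, (δ : ℚ_[ℓ]) • (w' - (b : ℚ_[ℓ]) • ((ℓ : ℚ_[ℓ]) • θ w')),
    hsmul _ _ (Λ.sub_mem hw' (hsmul _ _ (hψ _ hw'))), ?_, ?_⟩
  · simp only [map_smul, map_sub, smul_eq_mul, ← hadj, hb]
    linear_combination (-δ * b : ℚ_[ℓ]) * h1
  · simp only [map_smul, map_sub, smul_eq_mul]
    push_cast at hδ
    linear_combination hδ + (δ : ℚ_[ℓ]) * h1 - δ * b * ℓ * h2

theorem exists_isAdapted (h4 : Module.finrank ℚ_[ℓ] V = 4)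
    (B : V →ₗ[ℚ_[ℓ]] V →ₗ[ℚ_[ℓ]] ℚ_[ℓ]) (halt : ∀ v, B v v = 0)
    (θ : V →ₗ[ℚ_[ℓ]] V) (hadj : ∀ u v, B (θ u) v = B u (θ v))
    (c t : ℤ_[ℓ]) (hθ : ∀ v, θ (θ v) = (c : ℚ_[ℓ]) • v + (t : ℚ_[ℓ]) • θ v)
    (Λ : Submodule ℤ_[ℓ] V)
    (hsd : (Λ : Set V) = {v : V | ∀ w ∈ Λ, ∃ c : ℤ_[ℓ], B v w = (c : ℚ_[ℓ])})
    (hψ : ∀ v ∈ Λ, (ℓ : ℚ_[ℓ]) • θ v ∈ Λ) (hnot : ¬ ∀ v ∈ Λ, θ v ∈ Λ) :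
    ∃ h, IsAdapted B θ c t Λ h := by
  obtain ⟨u₁, hu₁, u₂, hu₂, h12, hθ12⟩ :=
    exists_hyperbolic_generators B θ hadj c t hθ Λ hsd hψ hnot
  have hskew : ∀ u v, B u v = -B v u := fun u v => by
    have := halt (u + v)
    simp only [map_add, LinearMap.add_apply, halt] at this
    linear_combination this
  have hself : ∀ u, B (θ u) u = 0 := fun u => by
    have := hskew (θ u) u
    rw [hadj] at this ⊢
    linear_combination this / 2
  have hmem : ∀ v, v ∈ Λ ↔ ∀ w ∈ Λ, ∃ c : ℤ_[ℓ], B v w = (c : ℚ_[ℓ]) := fun v => by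
    rw [← SetLike.mem_coe, hsd, Set.mem_ofPred_eq]
  set e₁ := (ℓ : ℚ_[ℓ]) • θ u₁ with he₁
  set e₂ := (ℓ : ℚ_[ℓ]) • θ u₂ with he₂
  have hθe : ∀ u, (ℓ : ℚ_[ℓ]) • θ ((ℓ : ℚ_[ℓ]) • θ u) =
      ((ℓ : ℚ_[ℓ]) ^ 2 * c) • u + (ℓ * t : ℚ_[ℓ]) • ((ℓ : ℚ_[ℓ]) • θ u) := fun u => by
    rw [map_smul, hθ]
    module
  have b11 : B u₁ e₁ = 0 := by rw [he₁, map_smul, ← hadj, hself, smul_zero]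
  have b22 : B u₂ e₂ = 0 := by rw [he₂, map_smul, ← hadj, hself, smul_zero]
  have b12 : B u₁ e₂ = 1 := by rw [he₂, map_smul, ← hadj, smul_eq_mul, hθ12]
  have b12' : B e₁ u₂ = 1 := by rw [he₁, map_smul, LinearMap.smul_apply, smul_eq_mul, hθ12]
  have bee : B e₁ e₂ = ℓ * t := by
    rw [he₂, map_smul, ← hadj, smul_eq_mul, ← smul_eq_mul, ← LinearMap.smul_apply, ← map_smul, he₁,
      hθe, ← he₁, map_add, LinearMap.add_apply, map_smul, map_smul, LinearMap.smul_apply,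
      LinearMap.smul_apply, h12, b12']
    simp
  have b21 : B u₂ e₁ = -1 := by rw [hskew, b12']
  have b11' : B e₁ u₁ = 0 := by rw [hskew, b11, neg_zero]
  have b22' : B e₂ u₂ = 0 := by rw [hskew, b22, neg_zero]
  have b21' : B e₂ u₁ = -1 := by rw [hskew, b12]
  have bee' : B e₂ e₁ = -(ℓ * t) := by rw [hskew, bee]
  have h21 : B u₂ u₁ = 0 := by rw [hskew, h12, neg_zero]
  let H : (ℚ_[ℓ] × ℚ_[ℓ] × ℚ_[ℓ] × ℚ_[ℓ]) →ₗ[ℚ_[ℓ]] V :=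
    (LinearMap.toSpanSingleton ℚ_[ℓ] V u₁).coprod ((LinearMap.toSpanSingleton ℚ_[ℓ] V u₂).coprod
      ((LinearMap.toSpanSingleton ℚ_[ℓ] V e₁).coprod (LinearMap.toSpanSingleton ℚ_[ℓ] V e₂)))
  have hH : ∀ x, H x = x.1 • u₁ + (x.2.1 • u₂ + (x.2.2.1 • e₁ + x.2.2.2 • e₂)) := fun x => by
    simp [H]
  have hB : ∀ x y, B (H x) (H y) =
      sympForm x y + ℓ * t * (x.2.2.1 * y.2.2.2 - x.2.2.2 * y.2.2.1) := fun x y => by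
    simp only [hH, map_add, map_smul, LinearMap.add_apply, LinearMap.smul_apply, smul_eq_mul, halt,
      h12, h21, b11, b22, b12, b12', b21, b11', b22', b21', bee, bee', sympForm]
    ring
  have hu₁' : H (1, 0, 0, 0) = u₁ := by simp [hH]
  have hu₂' : H (0, 1, 0, 0) = u₂ := by simp [hH]
  have he₁' : H (0, 0, 1, 0) = e₁ := by simp [hH]
  have he₂' : H (0, 0, 0, 1) = e₂ := by simp [hH]
  have c3 : ∀ x, x.2.2.1 = B (H x) u₂ := fun x => by rw [← hu₂', hB]; simp [sympForm]
  have c4 : ∀ x, x.2.2.2 = -B (H x) u₁ := fun x => by rw [← hu₁', hB]; simp [sympForm]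
  have c1 : ∀ x, x.1 = B (H x) e₂ - ℓ * t * x.2.2.1 := fun x => by
    rw [← he₂', hB]; simp [sympForm]
  have c2 : ∀ x, x.2.1 = -B (H x) e₁ - ℓ * t * x.2.2.2 := fun x => by
    rw [← he₁', hB]; simp [sympForm]
  have hinj : Function.Injective H := by
    rw [← LinearMap.ker_eq_bot, LinearMap.ker_eq_bot']
    intro x hx
    have d3 := c3 x
    have d4 := c4 x
    have d1 := c1 x
    have d2 := c2 x
    rw [hx, map_zero, LinearMap.zero_apply] at d1 d2 d3 d4
    rw [d3] at d1
    rw [d4] at d2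
    simp only [neg_zero, mul_zero, sub_zero] at d1 d2 d4
    exact Prod.ext d1 (Prod.ext d2 (Prod.ext d3 d4))
  have : FiniteDimensional ℚ_[ℓ] V := Module.finite_of_finrank_pos (by omega)
  have hsurj : Function.Surjective H :=
    (LinearMap.injective_iff_surjective_of_finrank_eq_finrank (by simp [h4])).1 hinj
  let h : (ℤ_[ℓ] × ℤ_[ℓ] × ℤ_[ℓ] × ℤ_[ℓ]) →ₗ[ℤ_[ℓ]] V :=
    (LinearMap.toSpanSingleton ℤ_[ℓ] V u₁).coprod ((LinearMap.toSpanSingleton ℤ_[ℓ] V u₂).coprod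
      ((LinearMap.toSpanSingleton ℤ_[ℓ] V e₁).coprod (LinearMap.toSpanSingleton ℤ_[ℓ] V e₂)))
  have hh : ∀ x, h x = H (x.1, x.2.1, x.2.2.1, x.2.2.2) := fun x => by
    simp [hH, h, PadicInt.coe_smul_eq]
  refine ⟨h, ⟨fun x y hxy => ?_, fun v => ⟨fun hv => ?_, ?_⟩, fun x => ?_, fun x y => ?_⟩⟩
  · rw [hh, hh] at hxy
    have := hinj hxy
    simp only [Prod.mk.injEq] at this
    exact Prod.ext (PadicInt.ext this.1) (Prod.ext (PadicInt.ext this.2.1)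
      (Prod.ext (PadicInt.ext this.2.2.1) (PadicInt.ext this.2.2.2)))
  · obtain ⟨x, rfl⟩ := hsurj v
    obtain ⟨x3, hx3⟩ := (hmem _).1 hv u₂ hu₂
    obtain ⟨x4, hx4⟩ := (hmem _).1 hv u₁ hu₁
    obtain ⟨y1, hy1⟩ := (hmem _).1 hv e₂ (hψ _ hu₂)
    obtain ⟨y2, hy2⟩ := (hmem _).1 hv e₁ (hψ _ hu₁)
    refine ⟨(y1 - ℓ * t * x3, -y2 - ℓ * t * -x4, x3, -x4), ?_⟩
    rw [hh]
    have d3 := c3 x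
    have d4 := c4 x
    have d1 := c1 x
    have d2 := c2 x
    rw [hx3] at d3
    rw [hx4] at d4
    rw [hy1, d3] at d1
    rw [hy2, d4] at d2
    congr 1
    push_cast
    exact Prod.ext d1.symm (Prod.ext d2.symm (Prod.ext d3.symm d4.symm))
  · rintro ⟨x, rfl⟩
    simp only [h, LinearMap.coprod_apply, LinearMap.toSpanSingleton_apply]
    exact Λ.add_mem (Λ.smul_mem _ hu₁) (Λ.add_mem (Λ.smul_mem _ hu₂)
      (Λ.add_mem (Λ.smul_mem _ (hψ _ hu₁)) (Λ.smul_mem _ (hψ _ hu₂))))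
  · have hθe₁ := hθe u₁
    have hθe₂ := hθe u₂
    rw [← he₁] at hθe₁
    rw [← he₂] at hθe₂
    simp only [hh, hH, map_add, map_smul, smul_add]
    simp only [smul_comm (ℓ : ℚ_[ℓ]), hθe₁, hθe₂, ← he₁, ← he₂]
    push_cast
    module
  · rw [hh, hh, hB]
    simp [sympForm]

end Coordinates

section Reduction

variable (ℓ : ℕ) [Fact ℓ.Prime]

/-- Coordinatewise reduction modulo `ℓ`. -/
noncomputable def modEll :
    ℤ_[ℓ] × ℤ_[ℓ] × ℤ_[ℓ] × ℤ_[ℓ] →+* ZMod ℓ × ZMod ℓ × ZMod ℓ × ZMod ℓ :=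
  PadicInt.toZMod.prodMap (PadicInt.toZMod.prodMap (PadicInt.toZMod.prodMap PadicInt.toZMod))

variable {ℓ}

theorem modEll_apply (x : ℤ_[ℓ] × ℤ_[ℓ] × ℤ_[ℓ] × ℤ_[ℓ]) : modEll ℓ x =
    (PadicInt.toZMod x.1, PadicInt.toZMod x.2.1, PadicInt.toZMod x.2.2.1,
      PadicInt.toZMod x.2.2.2) := rfl

theorem modEll_smul (a : ℤ_[ℓ]) (x : ℤ_[ℓ] × ℤ_[ℓ] × ℤ_[ℓ] × ℤ_[ℓ]) :
    modEll ℓ (a • x) = PadicInt.toZMod a • modEll ℓ x := by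
  simp [modEll_apply]

theorem PadicInt.toZMod_surjective : Function.Surjective (PadicInt.toZMod (p := ℓ)) :=
  ZMod.ringHom_surjective _

theorem PadicInt.toZMod_eq_zero_iff {a : ℤ_[ℓ]} : PadicInt.toZMod a = 0 ↔ (ℓ : ℤ_[ℓ]) ∣ a := by
  rw [← RingHom.mem_ker, PadicInt.ker_toZMod, PadicInt.maximalIdeal_eq_span_p,
    Ideal.mem_span_singleton]

theorem modEll_surjective : Function.Surjective (modEll ℓ) := by
  rintro ⟨a, b, c, d⟩
  obtain ⟨a, rfl⟩ := PadicInt.toZMod_surjective a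
  obtain ⟨b, rfl⟩ := PadicInt.toZMod_surjective b
  obtain ⟨c, rfl⟩ := PadicInt.toZMod_surjective c
  obtain ⟨d, rfl⟩ := PadicInt.toZMod_surjective d
  exact ⟨(a, b, c, d), rfl⟩

theorem modEll_eq_zero_iff {x : ℤ_[ℓ] × ℤ_[ℓ] × ℤ_[ℓ] × ℤ_[ℓ]} :
    modEll ℓ x = 0 ↔ ∃ y, x = (ℓ : ℤ_[ℓ]) • y := by
  constructor
  · intro h
    simp only [modEll_apply, Prod.mk_eq_zero, PadicInt.toZMod_eq_zero_iff] at h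
    obtain ⟨⟨a, ha⟩, ⟨b, hb⟩, ⟨c, hc⟩, ⟨d, hd⟩⟩ := h
    exact ⟨(a, b, c, d), Prod.ext ha (Prod.ext hb (Prod.ext hc hd))⟩
  · rintro ⟨y, rfl⟩
    rw [modEll_smul, PadicInt.toZMod_eq_zero_iff.2 dvd_rfl, zero_smul]

variable {V : Type*} [AddCommGroup V] [Module ℤ_[ℓ] V]

/-- The lattice with coordinates `h` whose reduction modulo `ℓ` is `L`. -/
noncomputable def latticeOf (h : (ℤ_[ℓ] × ℤ_[ℓ] × ℤ_[ℓ] × ℤ_[ℓ]) →ₗ[ℤ_[ℓ]] V)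
    (L : Submodule (ZMod ℓ) (ZMod ℓ × ZMod ℓ × ZMod ℓ × ZMod ℓ)) : Submodule ℤ_[ℓ] V where
  carrier := {v | ∃ x, h x = v ∧ modEll ℓ x ∈ L}
  zero_mem' := ⟨0, map_zero h, by rw [map_zero]; exact L.zero_mem⟩
  add_mem' := by
    rintro _ _ ⟨x, rfl, hx⟩ ⟨y, rfl, hy⟩
    exact ⟨x + y, map_add h x y, by rw [map_add]; exact L.add_mem hx hy⟩
  smul_mem' := by
    rintro a _ ⟨x, rfl, hx⟩
    exact ⟨a • x, map_smul h a x, by rw [modEll_smul]; exact L.smul_mem _ hx⟩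

theorem apply_mem_latticeOf {h : (ℤ_[ℓ] × ℤ_[ℓ] × ℤ_[ℓ] × ℤ_[ℓ]) →ₗ[ℤ_[ℓ]] V}
    (hinj : Function.Injective h)
    {L : Submodule (ZMod ℓ) (ZMod ℓ × ZMod ℓ × ZMod ℓ × ZMod ℓ)}
    {x : ℤ_[ℓ] × ℤ_[ℓ] × ℤ_[ℓ] × ℤ_[ℓ]} : h x ∈ latticeOf h L ↔ modEll ℓ x ∈ L :=
  ⟨fun ⟨_, hy, hyL⟩ => hinj hy ▸ hyL, fun hx => ⟨x, rfl, hx⟩⟩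

theorem latticeOf_injective {h : (ℤ_[ℓ] × ℤ_[ℓ] × ℤ_[ℓ] × ℤ_[ℓ]) →ₗ[ℤ_[ℓ]] V}
    (hinj : Function.Injective h) : Function.Injective (latticeOf h) := by
  intro L M hLM
  ext y
  obtain ⟨x, rfl⟩ := modEll_surjective y
  rw [← apply_mem_latticeOf hinj, hLM, apply_mem_latticeOf hinj]

theorem ellLat_le_self (Λ : Submodule ℤ_[ℓ] V) : ellLat ℓ V Λ ≤ Λ := by
  rintro _ ⟨v, hv, rfl⟩
  exact Λ.smul_mem _ hv

variable [Module ℚ_[ℓ] V] {B : V →ₗ[ℚ_[ℓ]] V →ₗ[ℚ_[ℓ]] ℚ_[ℓ]} {θ : V →ₗ[ℚ_[ℓ]] V} {c t : ℤ_[ℓ]}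
  {Λ : Submodule ℤ_[ℓ] V} {h : (ℤ_[ℓ] × ℤ_[ℓ] × ℤ_[ℓ] × ℤ_[ℓ]) →ₗ[ℤ_[ℓ]] V}
  {L : Submodule (ZMod ℓ) (ZMod ℓ × ZMod ℓ × ZMod ℓ × ZMod ℓ)}

namespace IsAdapted

theorem mem_ellLat_iff (H : IsAdapted B θ c t Λ h) {x : ℤ_[ℓ] × ℤ_[ℓ] × ℤ_[ℓ] × ℤ_[ℓ]} :
    h x ∈ ellLat ℓ V Λ ↔ modEll ℓ x = 0 := by
  rw [modEll_eq_zero_iff]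
  constructor
  · rintro ⟨v, hv, hvx⟩
    obtain ⟨y, rfl⟩ := (H.mem_iff v).1 hv
    refine ⟨y, H.injective ?_⟩
    rw [← hvx, map_smul]
    rfl
  · rintro ⟨y, rfl⟩
    exact ⟨h y, (H.mem_iff _).2 ⟨y, rfl⟩, (map_smul h _ y).symm⟩

theorem latticeOf_le (H : IsAdapted B θ c t Λ h) : latticeOf h L ≤ Λ := by
  rintro _ ⟨x, rfl, -⟩
  exact (H.mem_iff _).2 ⟨x, rfl⟩

theorem ellLat_le_latticeOf (H : IsAdapted B θ c t Λ h) : ellLat ℓ V Λ ≤ latticeOf h L := by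
  intro v hv
  obtain ⟨x, rfl⟩ := (H.mem_iff v).1 (ellLat_le_self Λ hv)
  rw [apply_mem_latticeOf H.injective, H.mem_ellLat_iff.1 hv]
  exact L.zero_mem

theorem exists_latticeOf_eq (H : IsAdapted B θ c t Λ h) {Γ : Submodule ℤ_[ℓ] V}
    (h₁ : ellLat ℓ V Λ ≤ Γ) (h₂ : Γ ≤ Λ) : ∃ L, latticeOf h L = Γ := by
  refine ⟨{
    carrier := {y | ∃ x, modEll ℓ x = y ∧ h x ∈ Γ}
    zero_mem' := ?_
    add_mem' := ?_
    smul_mem' := ?_ }, ?_⟩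
  · rintro _ _ ⟨x, rfl, hx⟩ ⟨y, rfl, hy⟩
    exact ⟨x + y, map_add _ x y, by rw [map_add]; exact Γ.add_mem hx hy⟩
  · exact ⟨0, map_zero _, by rw [map_zero]; exact Γ.zero_mem⟩
  · rintro a _ ⟨x, rfl, hx⟩
    obtain ⟨a, rfl⟩ := PadicInt.toZMod_surjective a
    exact ⟨a • x, modEll_smul a x, by rw [map_smul]; exact Γ.smul_mem a hx⟩
  · ext v
    constructor
    · rintro ⟨x, rfl, y, hyx, hy⟩
      have : h (x - y) ∈ ellLat ℓ V Λ := by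
        rw [H.mem_ellLat_iff, map_sub, hyx, sub_self]
      simpa using Γ.add_mem (h₁ this) hy
    · intro hv
      obtain ⟨x, rfl⟩ := (H.mem_iff v).1 (h₂ hv)
      exact ⟨x, rfl, x, rfl, hv⟩

theorem card_latticeOf_quotient (H : IsAdapted B θ c t Λ h) :
    Nat.card (latticeOf h L ⧸ Submodule.comap (latticeOf h L).subtype (ellLat ℓ V Λ)) =
      Nat.card L := by
  let σ := Function.surjInv (modEll_surjective (ℓ := ℓ))
  have hσ : ∀ y, modEll ℓ (σ y) = y := Function.surjInv_eq modEll_surjective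
  refine (Nat.card_eq_of_bijective (fun y : L => Submodule.Quotient.mk
    ⟨h (σ y), (apply_mem_latticeOf H.injective).2 ((hσ y).symm ▸ y.2)⟩) ⟨?_, ?_⟩).symm
  · intro y z hyz
    rw [Submodule.Quotient.eq, Submodule.mem_comap] at hyz
    change h (σ y) - h (σ z) ∈ _ at hyz
    rw [← map_sub, H.mem_ellLat_iff, map_sub, hσ, hσ, sub_eq_zero] at hyz
    exact Subtype.ext hyz
  · intro v
    obtain ⟨⟨_, x, rfl, hx⟩, rfl⟩ := Submodule.Quotient.mk_surjective _ v
    refine ⟨⟨modEll ℓ x, hx⟩, ?_⟩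
    rw [Submodule.Quotient.eq, Submodule.mem_comap]
    change h (σ (modEll ℓ x)) - h x ∈ _
    rw [← map_sub, H.mem_ellLat_iff, map_sub, hσ, sub_self]

theorem form_dvd_iff (H : IsAdapted B θ c t Λ h) (x y : ℤ_[ℓ] × ℤ_[ℓ] × ℤ_[ℓ] × ℤ_[ℓ]) :
    (∃ a : ℤ_[ℓ], B (h x) (h y) = (ℓ : ℚ_[ℓ]) * (a : ℚ_[ℓ])) ↔
      sympForm (modEll ℓ x) (modEll ℓ y) = 0 := by
  have : sympForm (modEll ℓ x) (modEll ℓ y) = PadicInt.toZMod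
      (sympForm x y + (ℓ : ℤ_[ℓ]) * t * (x.2.2.1 * y.2.2.2 - x.2.2.2 * y.2.2.1)) := by
    simp [sympForm, modEll_apply]
  rw [this, PadicInt.toZMod_eq_zero_iff, H.form_apply]
  refine exists_congr fun a => ⟨fun e => PadicInt.ext (e.trans (by push_cast; rfl)), fun e => ?_⟩
  rw [e]
  push_cast
  rfl

theorem isEllEllNeighbor_latticeOf_iff (H : IsAdapted B θ c t Λ h) :
    IsEllEllNeighbor ℓ V B Λ (latticeOf h L) ↔ IsLagrangian L := by
  rw [IsEllEllNeighbor, IsLagrangian, H.card_latticeOf_quotient, Nat.card_zmod]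
  simp only [H.ellLat_le_latticeOf, H.latticeOf_le, true_and]
  refine and_congr_left fun _ => ⟨fun hB x hx y hy => ?_, ?_⟩
  · obtain ⟨x, rfl⟩ := modEll_surjective x
    obtain ⟨y, rfl⟩ := modEll_surjective y
    exact (H.form_dvd_iff x y).1 (hB _ ⟨x, rfl, hx⟩ _ ⟨y, rfl, hy⟩)
  · rintro hB _ ⟨x, rfl, hx⟩ _ ⟨y, rfl, hy⟩
    exact (H.form_dvd_iff x y).2 (hB _ hx _ hy)

/-- The neighbors of `Λ` satisfying `P` correspond to the Lagrangian planes satisfying `Q`. -/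
theorem setOf_isEllEllNeighbor_eq_image (H : IsAdapted B θ c t Λ h)
    {P : Submodule ℤ_[ℓ] V → Prop}
    {Q : Submodule (ZMod ℓ) (ZMod ℓ × ZMod ℓ × ZMod ℓ × ZMod ℓ) → Prop}
    (hPQ : ∀ L, IsLagrangian L → (P (latticeOf h L) ↔ Q L)) :
    {Γ | IsEllEllNeighbor ℓ V B Λ Γ ∧ P Γ} = latticeOf h '' {L | IsLagrangian L ∧ Q L} := by
  ext Γ
  constructor
  · rintro ⟨hΓ, hP⟩
    obtain ⟨L, rfl⟩ := H.exists_latticeOf_eq hΓ.1 hΓ.2.1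
    have hL := H.isEllEllNeighbor_latticeOf_iff.1 hΓ
    exact ⟨L, ⟨hL, (hPQ L hL).1 hP⟩, rfl⟩
  · rintro ⟨L, ⟨hL, hQ⟩, rfl⟩
    exact ⟨H.isEllEllNeighbor_latticeOf_iff.2 hL, (hPQ L hL).2 hQ⟩

theorem modEll_smul_apply (x : ℤ_[ℓ] × ℤ_[ℓ] × ℤ_[ℓ] × ℤ_[ℓ]) :
    modEll ℓ (ℓ ^ 2 * c * x.2.2.1, ℓ ^ 2 * c * x.2.2.2, x.1 + ℓ * t * x.2.2.1,
      x.2.1 + ℓ * t * x.2.2.2) = shift (modEll ℓ x) := by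
  simp [modEll_apply, shift]

theorem ell_smul_mem_latticeOf_iff (H : IsAdapted B θ c t Λ h) :
    (∀ v ∈ latticeOf h L, (ℓ : ℚ_[ℓ]) • θ v ∈ latticeOf h L) ↔ ∀ x ∈ L, shift x ∈ L := by
  constructor
  · intro hψ x hx
    obtain ⟨x, rfl⟩ := modEll_surjective x
    have := hψ _ ⟨x, rfl, hx⟩
    rwa [H.smul_apply, apply_mem_latticeOf H.injective, modEll_smul_apply] at this
  · rintro hs _ ⟨x, rfl, hx⟩
    rw [H.smul_apply, apply_mem_latticeOf H.injective, modEll_smul_apply]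
    exact hs _ hx

variable [IsScalarTower ℤ_[ℓ] ℚ_[ℓ] V]

theorem smul_mem_latticeOf_iff (H : IsAdapted B θ c t Λ h) (hL : IsLagrangian L) :
    (∀ v ∈ latticeOf h L, θ v ∈ latticeOf h L) ↔ ∀ x ∈ L, shift x = 0 := by
  constructor
  · intro hθ x hx
    obtain ⟨x, rfl⟩ := modEll_surjective x
    rw [← modEll_smul_apply (c := c) (t := t), ← H.mem_ellLat_iff, ← H.smul_apply]
    refine ⟨_, H.latticeOf_le (hθ _ ⟨x, rfl, hx⟩), ?_⟩
    exact (PadicInt.coe_smul_eq (ℓ : ℤ_[ℓ]) _).symm.trans (by rw [PadicInt.coe_natCast])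
  · intro hs
    have hK := hL.shift_eq_zero_iff.1 hs
    subst hK
    rintro _ ⟨⟨x1, x2, x3, x4⟩, rfl, hx⟩
    simp only [modEll_apply, mem_shiftKer, PadicInt.toZMod_eq_zero_iff] at hx
    obtain ⟨⟨a, rfl⟩, b, rfl⟩ := hx
    have hℓ : (ℓ : ℚ_[ℓ]) ≠ 0 := by exact_mod_cast (Fact.out : ℓ.Prime).ne_zero
    refine ⟨(ℓ * c * x3, ℓ * c * x4, a + t * x3, b + t * x4), ?_, ?_⟩
    · refine smul_right_injective V hℓ ?_
      simp only
      rw [H.smul_apply, ← PadicInt.coe_natCast, PadicInt.coe_smul_eq, ← map_smul]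
      simp only [Prod.smul_mk, smul_eq_mul]
      congr 1
      simp only [Prod.mk.injEq]
      refine ⟨?_, ?_, ?_, ?_⟩ <;> ring
    · simp [modEll_apply, mem_shiftKer]

end IsAdapted

end Reduction

theorem IsAdapted.smul_smul_apply {ℓ : ℕ} [Fact ℓ.Prime] {A V : Type*} [CommRing A] [Algebra ℚ_[ℓ] A]
    [AddCommGroup V] [Module ℚ_[ℓ] V] [Module ℤ_[ℓ] V] [IsScalarTower ℤ_[ℓ] ℚ_[ℓ] V] [Module A V]
    [IsScalarTower ℚ_[ℓ] A V] {B : V →ₗ[ℚ_[ℓ]] V →ₗ[ℚ_[ℓ]] ℚ_[ℓ]} {θ : A} {c t : ℤ_[ℓ]}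
    {Λ : Submodule ℤ_[ℓ] V} {h : (ℤ_[ℓ] × ℤ_[ℓ] × ℤ_[ℓ] × ℤ_[ℓ]) →ₗ[ℤ_[ℓ]] V}
    (H : IsAdapted B (Algebra.lsmul ℚ_[ℓ] ℚ_[ℓ] V θ) c t Λ h)
    (x : ℤ_[ℓ] × ℤ_[ℓ] × ℤ_[ℓ] × ℤ_[ℓ]) : (ℓ : ℤ_[ℓ]) • θ • h x =
    h (ℓ ^ 2 * c * x.2.2.1, ℓ ^ 2 * c * x.2.2.2, x.1 + ℓ * t * x.2.2.1,
      x.2.1 + ℓ * t * x.2.2.2) := by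
  rw [← H.smul_apply, ← PadicInt.coe_smul_eq, PadicInt.coe_natCast]
  rfl

section Orders

variable {ℓ : ℕ} [Fact ℓ.Prime] {A : Type*} [CommRing A] [Algebra ℚ_[ℓ] A] [Algebra ℤ_[ℓ] A]

/-- The `ℤ_ℓ`-module `ℤ_ℓ + ℓʲℤ_ℓ θ`. -/
def orderLevel (θ : A) (j : ℕ) : Set A :=
  {x | ∃ a d : ℤ_[ℓ], x = algebraMap ℤ_[ℓ] A a + algebraMap ℤ_[ℓ] A (ℓ ^ j * d) * θ}

variable [IsScalarTower ℤ_[ℓ] ℚ_[ℓ] A]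

theorem algebraMap_mul_ne_of_not_scalar {θ : A} (hθ : ∀ q : ℚ_[ℓ], θ ≠ algebraMap ℚ_[ℓ] A q)
    {a b : ℤ_[ℓ]} (ha : a ≠ 0) : algebraMap ℤ_[ℓ] A a * θ ≠ algebraMap ℤ_[ℓ] A b := by
  intro h
  rw [IsScalarTower.algebraMap_apply ℤ_[ℓ] ℚ_[ℓ] A, IsScalarTower.algebraMap_apply ℤ_[ℓ] ℚ_[ℓ] A,
    PadicInt.algebraMap_apply, PadicInt.algebraMap_apply] at h
  have ha' : (a : ℚ_[ℓ]) ≠ 0 := fun h0 => ha (PadicInt.ext h0)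
  refine hθ ((a : ℚ_[ℓ])⁻¹ * b) ?_
  rw [map_mul, ← h, ← mul_assoc, ← map_mul, inv_mul_cancel₀ ha', map_one, one_mul]

theorem pow_mul_notMem_orderLevel {θ : A} (hθ : ∀ q : ℚ_[ℓ], θ ≠ algebraMap ℚ_[ℓ] A q) (j : ℕ) :
    algebraMap ℤ_[ℓ] A (ℓ ^ j) * θ ∉ orderLevel (ℓ := ℓ) θ (j + 1) := by
  rintro ⟨a, d, h⟩
  have hne : (ℓ : ℤ_[ℓ]) ^ j * (1 - ℓ * d) ≠ 0 :=
    mul_ne_zero (pow_ne_zero _ PadicInt.prime_p.ne_zero)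
      fun h0 => PadicInt.not_dvd_one_sub_mul d (h0 ▸ dvd_zero _)
  refine algebraMap_mul_ne_of_not_scalar hθ hne (b := a) ?_
  simp only [map_mul, map_sub, map_one, map_pow] at h ⊢
  linear_combination h

variable {V : Type*} [AddCommGroup V] [Module ℚ_[ℓ] V] [Module ℤ_[ℓ] V]
  [IsScalarTower ℤ_[ℓ] ℚ_[ℓ] V] [Module A V] [IsScalarTower ℚ_[ℓ] A V]

theorem algebraMap_padicInt_smul (a : ℤ_[ℓ]) (v : V) : algebraMap ℤ_[ℓ] A a • v = a • v := by
  rw [IsScalarTower.algebraMap_apply ℤ_[ℓ] ℚ_[ℓ] A, algebraMap_smul, algebraMap_smul]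

theorem algebraMap_add_mul_smul (a d : ℤ_[ℓ]) (θ : A) (v : V) :
    (algebraMap ℤ_[ℓ] A a + algebraMap ℤ_[ℓ] A d * θ) • v = a • v + d • (θ • v) := by
  rw [add_smul, mul_smul, algebraMap_padicInt_smul, algebraMap_padicInt_smul]

theorem stabilizer_eq_orderLevel_zero_iff {θ : A} {Γ : Submodule ℤ_[ℓ] V}
    (hΓ : ∀ x : A, (∀ v ∈ Γ, x • v ∈ Γ) → x ∈ orderLevel (ℓ := ℓ) θ 0) :
    {x : A | ∀ v ∈ Γ, x • v ∈ Γ} = orderLevel (ℓ := ℓ) θ 0 ↔ ∀ v ∈ Γ, θ • v ∈ Γ := by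
  constructor
  · intro h
    have : θ ∈ orderLevel (ℓ := ℓ) θ 0 := ⟨0, 1, by simp⟩
    rwa [← h] at this
  · refine fun h => Set.Subset.antisymm hΓ ?_
    rintro _ ⟨a, d, rfl⟩ v hv
    rw [algebraMap_add_mul_smul]
    exact Γ.add_mem (Γ.smul_mem _ hv) (Γ.smul_mem _ (h v hv))

theorem stabilizer_eq_orderLevel_succ_iff {θ : A} (hθ : ∀ q : ℚ_[ℓ], θ ≠ algebraMap ℚ_[ℓ] A q)
    {Γ : Submodule ℤ_[ℓ] V}
    (hΓ : ∀ x : A, (∀ v ∈ Γ, x • v ∈ Γ) → x ∈ orderLevel (ℓ := ℓ) θ 0) (j : ℕ) :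
    {x : A | ∀ v ∈ Γ, x • v ∈ Γ} = orderLevel (ℓ := ℓ) θ (j + 1) ↔
      (∀ v ∈ Γ, (ℓ : ℤ_[ℓ]) ^ (j + 1) • θ • v ∈ Γ) ∧ ¬ ∀ v ∈ Γ, (ℓ : ℤ_[ℓ]) ^ j • θ • v ∈ Γ := by
  have hact : ∀ (d : ℤ_[ℓ]) (v : V), (algebraMap ℤ_[ℓ] A d * θ) • v = d • θ • v := fun d v => by
    rw [mul_smul, algebraMap_padicInt_smul]
  constructor
  · refine fun h => ⟨fun v hv => ?_, fun h' => pow_mul_notMem_orderLevel hθ j ?_⟩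
    · have : algebraMap ℤ_[ℓ] A (ℓ ^ (j + 1)) * θ ∈ orderLevel (ℓ := ℓ) θ (j + 1) :=
        ⟨0, 1, by simp⟩
      rw [← h] at this
      rw [← hact]
      exact this v hv
    · rw [← h]
      intro v hv
      rw [hact]
      exact h' v hv
  · rintro ⟨h1, h2⟩
    refine Set.Subset.antisymm (fun x hx => ?_) ?_
    · obtain ⟨a, d, rfl⟩ := hΓ x hx
      rw [pow_zero, one_mul] at hx ⊢
      have hd : ∀ v ∈ Γ, d • θ • v ∈ Γ := fun v hv => by
        have := Γ.sub_mem (hx v hv) (Γ.smul_mem a hv)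
        rwa [algebraMap_add_mul_smul, add_sub_cancel_left] at this
      suffices (ℓ : ℤ_[ℓ]) ^ (j + 1) ∣ d by
        obtain ⟨e, rfl⟩ := this
        exact ⟨a, e, rfl⟩
      by_cases hd0 : d = 0
      · exact hd0 ▸ dvd_zero _
      by_contra hdvd
      obtain ⟨u, k, rfl⟩ : ∃ (u : ℤ_[ℓ]ˣ) (k : ℕ), d = u * (ℓ : ℤ_[ℓ]) ^ k :=
        ⟨_, _, PadicInt.unitCoeff_spec hd0⟩
      have hle : k ≤ j := by
        by_contra! hlt
        exact hdvd ((pow_dvd_pow _ hlt).mul_left _)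
      refine h2 fun v hv => ?_
      have := Γ.smul_mem ((ℓ : ℤ_[ℓ]) ^ (j - k) * ((u⁻¹ : ℤ_[ℓ]ˣ) : ℤ_[ℓ])) (hd v hv)
      rw [← mul_smul, mul_assoc, ← mul_assoc _ (u : ℤ_[ℓ]), Units.inv_mul, one_mul, ← pow_add,
        Nat.sub_add_cancel hle] at this
      exact this
    · rintro _ ⟨a, d, rfl⟩ v hv
      rw [algebraMap_add_mul_smul, mul_comm, mul_smul]
      exact Γ.add_mem (Γ.smul_mem _ hv) (Γ.smul_mem _ (h1 v hv))

variable {B : V →ₗ[ℚ_[ℓ]] V →ₗ[ℚ_[ℓ]] ℚ_[ℓ]} {θ : A} {c t : ℤ_[ℓ]}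
  {Λ : Submodule ℤ_[ℓ] V} {h : (ℤ_[ℓ] × ℤ_[ℓ] × ℤ_[ℓ] × ℤ_[ℓ]) →ₗ[ℤ_[ℓ]] V}
  {L : Submodule (ZMod ℓ) (ZMod ℓ × ZMod ℓ × ZMod ℓ × ZMod ℓ)}

namespace IsAdapted

/-- The real order of a neighbor is contained in `ℤ_ℓ + ℤ_ℓ θ`. -/
theorem mem_orderLevel_zero (H : IsAdapted B (Algebra.lsmul ℚ_[ℓ] ℚ_[ℓ] V θ) c t Λ h)
    (hΛ : {x : A | ∀ v ∈ Λ, x • v ∈ Λ} = orderLevel (ℓ := ℓ) θ 1) (hL : IsLagrangian L) (x : A)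
    (hx : ∀ v ∈ latticeOf h L, x • v ∈ latticeOf h L) : x ∈ orderLevel (ℓ := ℓ) θ 0 := by
  have hx' : algebraMap ℤ_[ℓ] A ℓ * x ∈ {x : A | ∀ v ∈ Λ, x • v ∈ Λ} := fun v hv => by
    rw [mul_comm, mul_smul, algebraMap_padicInt_smul]
    exact H.latticeOf_le (hx _ (H.ellLat_le_latticeOf ⟨v, hv, rfl⟩))
  rw [hΛ] at hx'
  obtain ⟨a, d, had⟩ := hx'
  rw [pow_one] at had
  have hkill : ∀ y ∈ L, PadicInt.toZMod a • y + PadicInt.toZMod d • shift y = 0 := by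
    intro y hy
    obtain ⟨y, rfl⟩ := modEll_surjective y
    rw [← modEll_smul_apply (c := c) (t := t), ← modEll_smul, ← modEll_smul, ← map_add,
      ← H.mem_ellLat_iff, map_add, map_smul, map_smul, ← H.smul_smul_apply, ← mul_smul,
      mul_comm d, ← algebraMap_add_mul_smul, ← had, mul_smul, algebraMap_padicInt_smul]
    exact ⟨_, H.latticeOf_le (hx _ ⟨y, rfl, hy⟩), rfl⟩
  have ha : PadicInt.toZMod a = 0 := by
    by_contra ha
    have hbot : L = ⊥ := by
      refine (Submodule.eq_bot_iff L).2 fun y hy => ?_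
      have := hkill y hy
      simp only [shift, Prod.ext_iff, Prod.fst_add, Prod.snd_add, Prod.smul_fst, Prod.smul_snd,
        smul_eq_mul, mul_zero, add_zero, Prod.fst_zero, Prod.snd_zero, mul_eq_zero, ha,
        false_or] at this
      obtain ⟨h1, h2, h3, h4⟩ := this
      simp only [h1, h2, mul_zero, add_zero, mul_eq_zero, ha, false_or] at h3 h4
      exact Prod.ext h1 (Prod.ext h2 (Prod.ext h3 h4))
    have hcard := hL.2
    subst hbot
    rw [Nat.card_zmod, Nat.card_unique] at hcard
    exact (Nat.one_lt_pow two_ne_zero (Fact.out : ℓ.Prime).one_lt).ne hcard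
  obtain ⟨a', rfl⟩ := PadicInt.toZMod_eq_zero_iff.1 ha
  refine ⟨a', d, ?_⟩
  have hunit : IsUnit (algebraMap ℤ_[ℓ] A ℓ) := by
    rw [IsScalarTower.algebraMap_apply ℤ_[ℓ] ℚ_[ℓ] A]
    refine IsUnit.map _ (isUnit_iff_ne_zero.2 ?_)
    rw [map_natCast]
    exact_mod_cast (Fact.out : ℓ.Prime).ne_zero
  refine hunit.mul_left_cancel (had.trans ?_)
  simp only [map_mul, pow_zero, one_mul]
  ring

theorem stabilizer_eq_zero_iff (H : IsAdapted B (Algebra.lsmul ℚ_[ℓ] ℚ_[ℓ] V θ) c t Λ h)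
    (hΛ : {x : A | ∀ v ∈ Λ, x • v ∈ Λ} = orderLevel (ℓ := ℓ) θ 1) (hL : IsLagrangian L) :
    {x : A | ∀ v ∈ latticeOf h L, x • v ∈ latticeOf h L} = orderLevel (ℓ := ℓ) θ 0 ↔
      L = shiftKer (ZMod ℓ) :=
  (stabilizer_eq_orderLevel_zero_iff (H.mem_orderLevel_zero hΛ hL)).trans
    ((H.smul_mem_latticeOf_iff hL).trans hL.shift_eq_zero_iff)

theorem stabilizer_eq_one_iff (H : IsAdapted B (Algebra.lsmul ℚ_[ℓ] ℚ_[ℓ] V θ) c t Λ h)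
    (hθ : ∀ q : ℚ_[ℓ], θ ≠ algebraMap ℚ_[ℓ] A q)
    (hΛ : {x : A | ∀ v ∈ Λ, x • v ∈ Λ} = orderLevel (ℓ := ℓ) θ 1) (hL : IsLagrangian L) :
    {x : A | ∀ v ∈ latticeOf h L, x • v ∈ latticeOf h L} = orderLevel (ℓ := ℓ) θ 1 ↔
      (∀ x ∈ L, shift x ∈ L) ∧ ¬ ∀ x ∈ L, shift x = 0 := by
  rw [stabilizer_eq_orderLevel_succ_iff hθ (H.mem_orderLevel_zero hΛ hL) 0,
    ← H.smul_mem_latticeOf_iff hL, ← H.ell_smul_mem_latticeOf_iff]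
  simp only [← PadicInt.coe_smul_eq, zero_add, pow_one, pow_zero, PadicInt.coe_natCast,
    one_smul, Algebra.lsmul_coe]

theorem stabilizer_eq_two_iff (H : IsAdapted B (Algebra.lsmul ℚ_[ℓ] ℚ_[ℓ] V θ) c t Λ h)
    (hθ : ∀ q : ℚ_[ℓ], θ ≠ algebraMap ℚ_[ℓ] A q)
    (hΛ : {x : A | ∀ v ∈ Λ, x • v ∈ Λ} = orderLevel (ℓ := ℓ) θ 1) (hL : IsLagrangian L) :
    {x : A | ∀ v ∈ latticeOf h L, x • v ∈ latticeOf h L} = orderLevel (ℓ := ℓ) θ 2 ↔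
      ¬ ∀ x ∈ L, shift x ∈ L := by
  rw [stabilizer_eq_orderLevel_succ_iff hθ (H.mem_orderLevel_zero hΛ hL) 1,
    ← H.ell_smul_mem_latticeOf_iff]
  have hall : ∀ v ∈ latticeOf h L, (ℓ : ℤ_[ℓ]) ^ (1 + 1) • θ • v ∈ latticeOf h L := by
    rintro _ ⟨x, rfl, -⟩
    rw [pow_succ, pow_one, mul_smul, H.smul_smul_apply]
    exact H.ellLat_le_latticeOf ⟨_, (H.mem_iff _).2 ⟨_, rfl⟩, rfl⟩
  simp only [← PadicInt.coe_smul_eq, pow_one, PadicInt.coe_natCast, Algebra.lsmul_coe] at hall ⊢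
  exact and_iff_right hall

theorem span_eq_latticeOf_shiftKer (H : IsAdapted B (Algebra.lsmul ℚ_[ℓ] ℚ_[ℓ] V θ) c t Λ h) :
    Submodule.span ℤ_[ℓ] {u : V | ∃ x ∈ orderLevel (ℓ := ℓ) θ 0, ∃ v ∈ Λ,
      u = (ℓ : ℚ_[ℓ]) • (x • v)} = latticeOf h (shiftKer (ZMod ℓ)) := by
  have hmem : ∀ x, h x ∈ Λ := fun x => (H.mem_iff _).2 ⟨x, rfl⟩
  refine le_antisymm (Submodule.span_le.2 ?_) ?_
  · rintro _ ⟨_, ⟨a, d, rfl⟩, v, hv, rfl⟩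
    obtain ⟨x, rfl⟩ := (H.mem_iff v).1 hv
    rw [← PadicInt.coe_natCast, PadicInt.coe_smul_eq, algebraMap_add_mul_smul, smul_add,
      smul_comm _ a, smul_comm _ _ (θ • h x), H.smul_smul_apply]
    refine (latticeOf h _).add_mem ((latticeOf h _).smul_mem _
      (H.ellLat_le_latticeOf ⟨_, hv, rfl⟩)) ((latticeOf h _).smul_mem _ ⟨_, rfl, ?_⟩)
    rw [modEll_smul_apply]
    simp [shift, mem_shiftKer]
  · rintro _ ⟨⟨x1, x2, x3, x4⟩, rfl, hx⟩
    simp only [modEll_apply, mem_shiftKer, PadicInt.toZMod_eq_zero_iff] at hx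
    obtain ⟨⟨a, rfl⟩, b, rfl⟩ := hx
    have : h (ℓ * a, ℓ * b, x3, x4) = (ℓ : ℚ_[ℓ]) • ((1 : A) • h (a, b, 0, 0)) +
        (ℓ : ℚ_[ℓ]) • (θ • h (x3, x4, 0, 0)) := by
      rw [← PadicInt.coe_natCast, PadicInt.coe_smul_eq, PadicInt.coe_smul_eq, H.smul_smul_apply,
        one_smul, ← map_smul, ← map_add]
      simp
    rw [this]
    exact Submodule.add_mem _
      (Submodule.subset_span ⟨1, ⟨1, 0, by simp⟩, _, hmem _, rfl⟩)
      (Submodule.subset_span ⟨θ, ⟨0, 1, by simp⟩, _, hmem _, rfl⟩)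

end IsAdapted

theorem realOrderLevel_eq_orderLevel {ℓ : ℕ} [Fact ℓ.Prime] {K₀ : Type*} [Field K₀]
    [NumberField K₀] {ω : ℚ_[ℓ] ⊗[ℚ] K₀} (hω : ω ∈ maxRealLocalOrder ℓ K₀)
    (hspan : ∀ y ∈ maxRealLocalOrder ℓ K₀, ∃ c d : ℤ_[ℓ],
      y = algebraMap ℤ_[ℓ] (ℚ_[ℓ] ⊗[ℚ] K₀) c + algebraMap ℤ_[ℓ] (ℚ_[ℓ] ⊗[ℚ] K₀) d * ω)
    (m j : ℕ) : realOrderLevel ℓ K₀ (m + j) =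
      orderLevel (ℓ := ℓ) (algebraMap ℤ_[ℓ] (ℚ_[ℓ] ⊗[ℚ] K₀) (ℓ ^ m) * ω) j := by
  ext x
  constructor
  · rintro ⟨a, y, hy, rfl⟩
    obtain ⟨c, d, rfl⟩ := hspan y hy
    refine ⟨a + ℓ ^ (m + j) * c, d, ?_⟩
    simp only [map_add, map_mul, map_pow, map_natCast]
    ring
  · rintro ⟨a, d, rfl⟩
    refine ⟨a, algebraMap ℤ_[ℓ] _ d * ω,
      Subalgebra.mul_mem _ (Subalgebra.algebraMap_mem _ d) hω, ?_⟩
    simp only [map_mul, map_pow, map_natCast]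
    ring

end Orders

/-- Let `ℓ` be a prime, `K₀` a real quadratic number field, `A = K₀ ⊗_ℚ ℚ_ℓ`,
`R_n = ℤ_ℓ + ℓⁿ R₀`.  Let `V` be a 4-dimensional symplectic `ℚ_ℓ`-vector space with a
self-adjoint `A`-action and `Λ` a self-dual full `ℤ_ℓ`-lattice whose real order is `R_n`,
`n > 0`.  Then among the `(ℓ,ℓ)`-neighbors of `Λ`: exactly one has real order `R_{n-1}`,
namely `ℓ·R_{n-1}·Λ`; exactly `ℓ² + ℓ` have real order `R_n`; and exactly `ℓ³` have real
order `R_{n+1}`. -/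
theorem ellell_neighbors_real_orders (ℓ : ℕ) [Fact ℓ.Prime]
    (K₀ : Type*) [Field K₀] [NumberField K₀]
    (hdeg : Module.finrank ℚ K₀ = 2)
    (hreal : ∀ φ : K₀ →+* ℂ, ∀ x : K₀, (φ x).im = 0)
    (V : Type*) [AddCommGroup V] [Module ℚ_[ℓ] V]
    [Module ℤ_[ℓ] V] [IsScalarTower ℤ_[ℓ] ℚ_[ℓ] V]
    [Module (ℚ_[ℓ] ⊗[ℚ] K₀) V] [IsScalarTower ℚ_[ℓ] (ℚ_[ℓ] ⊗[ℚ] K₀) V]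
    (h4 : Module.finrank ℚ_[ℓ] V = 4)
    (B : V →ₗ[ℚ_[ℓ]] V →ₗ[ℚ_[ℓ]] ℚ_[ℓ])
    (halt : ∀ v, B v v = 0)
    (hnd : ∀ v, (∀ w, B v w = 0) → v = 0)
    (hadj : ∀ (x : ℚ_[ℓ] ⊗[ℚ] K₀) (u v : V), B (x • u) v = B u (x • v))
    (Λ : Submodule ℤ_[ℓ] V) (hfg : Λ.FG)
    (hfull : Submodule.span ℚ_[ℓ] (Λ : Set V) = ⊤)
    (hsd : (Λ : Set V) = {v : V | ∀ w ∈ Λ, ∃ c : ℤ_[ℓ], B v w = (c : ℚ_[ℓ])})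
    (n : ℕ) (hn : 0 < n)
    (hord : {x : ℚ_[ℓ] ⊗[ℚ] K₀ | ∀ v ∈ Λ, x • v ∈ Λ} = realOrderLevel ℓ K₀ n) :
    {Γ : Submodule ℤ_[ℓ] V | IsEllEllNeighbor ℓ V B Λ Γ ∧
        {x : ℚ_[ℓ] ⊗[ℚ] K₀ | ∀ v ∈ Γ, x • v ∈ Γ} = realOrderLevel ℓ K₀ (n - 1)} =
      {Submodule.span ℤ_[ℓ] {u : V | ∃ x ∈ realOrderLevel ℓ K₀ (n - 1), ∃ v ∈ Λ,
        u = (ℓ : ℚ_[ℓ]) • (x • v)}} ∧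
    Nat.card {Γ : Submodule ℤ_[ℓ] V | IsEllEllNeighbor ℓ V B Λ Γ ∧
        {x : ℚ_[ℓ] ⊗[ℚ] K₀ | ∀ v ∈ Γ, x • v ∈ Γ} = realOrderLevel ℓ K₀ n} =
      ℓ ^ 2 + ℓ ∧
    Nat.card {Γ : Submodule ℤ_[ℓ] V | IsEllEllNeighbor ℓ V B Λ Γ ∧
        {x : ℚ_[ℓ] ⊗[ℚ] K₀ | ∀ v ∈ Γ, x • v ∈ Γ} = realOrderLevel ℓ K₀ (n + 1)} =
      ℓ ^ 3 := by
  obtain ⟨ω, hω, hspan, hns⟩ := exists_maxRealLocalOrder_generator ℓ K₀ hdeg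
  obtain ⟨m, rfl⟩ : ∃ m, n = m + 1 := ⟨n - 1, by omega⟩
  have hlevel := realOrderLevel_eq_orderLevel hω hspan m
  obtain ⟨c, t, hct⟩ := hspan _ (Subalgebra.mul_mem _ hω hω)
  set θ := algebraMap ℤ_[ℓ] (ℚ_[ℓ] ⊗[ℚ] K₀) (ℓ ^ m) * ω with hθ
  have hθns : ∀ q : ℚ_[ℓ], θ ≠ algebraMap ℚ_[ℓ] (ℚ_[ℓ] ⊗[ℚ] K₀) q := by
    intro q hq
    have hℓ : (ℓ : ℚ_[ℓ]) ^ m ≠ 0 :=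
      pow_ne_zero _ (by exact_mod_cast (Fact.out : ℓ.Prime).ne_zero)
    refine hns (((ℓ : ℚ_[ℓ]) ^ m)⁻¹ * q) ?_
    have hpow : algebraMap ℤ_[ℓ] (ℚ_[ℓ] ⊗[ℚ] K₀) (ℓ ^ m) =
        algebraMap ℚ_[ℓ] (ℚ_[ℓ] ⊗[ℚ] K₀) ((ℓ : ℚ_[ℓ]) ^ m) := by simp
    rw [map_mul, ← hq, hθ, hpow, ← mul_assoc, ← map_mul, inv_mul_cancel₀ hℓ, map_one, one_mul]
  have hθsq : θ * θ =
      algebraMap ℤ_[ℓ] _ (ℓ ^ (2 * m) * c) + algebraMap ℤ_[ℓ] _ (ℓ ^ m * t) * θ := by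
    simp only [hθ, map_mul, map_pow, map_natCast]
    linear_combination (ℓ : ℚ_[ℓ] ⊗[ℚ] K₀) ^ (2 * m) * hct
  have hΛ : {x : ℚ_[ℓ] ⊗[ℚ] K₀ | ∀ v ∈ Λ, x • v ∈ Λ} = orderLevel (ℓ := ℓ) θ 1 :=
    hord.trans (hlevel 1)
  obtain ⟨h, H⟩ := exists_isAdapted h4 B halt (Algebra.lsmul ℚ_[ℓ] ℚ_[ℓ] V θ)
    (fun u v => hadj θ u v) (ℓ ^ (2 * m) * c) (ℓ ^ m * t)
    (fun v => by
      rw [PadicInt.coe_smul_eq, PadicInt.coe_smul_eq]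
      simp only [Algebra.lsmul_coe]
      rw [← algebraMap_add_mul_smul, ← hθsq]
      exact (mul_smul _ _ v).symm)
    Λ hsd
    (fun v hv => by
      have : algebraMap ℤ_[ℓ] _ ℓ * θ ∈ orderLevel (ℓ := ℓ) θ 1 := ⟨0, 1, by simp⟩
      rw [← hΛ] at this
      have := this v hv
      rwa [mul_smul, algebraMap_padicInt_smul, ← PadicInt.coe_smul_eq, PadicInt.coe_natCast] at this)
    (fun hmem => by
      refine pow_mul_notMem_orderLevel hθns 0 ?_
      rw [zero_add, ← hΛ, pow_zero, map_one, one_mul]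
      exact hmem)
  have hcard := Nat.card_zmod ℓ
  rw [Nat.add_sub_cancel, hlevel 1, add_assoc m 1 1, hlevel (1 + 1)]
  have hlevel₀ := hlevel 0
  rw [add_zero] at hlevel₀
  rw [hlevel₀]
  refine ⟨?_, ?_, ?_⟩
  · rw [H.setOf_isEllEllNeighbor_eq_image fun L hL => H.stabilizer_eq_zero_iff hΛ hL,
      H.span_eq_latticeOf_shiftKer]
    have : {L | IsLagrangian L ∧ L = shiftKer (ZMod ℓ)} = {shiftKer (ZMod ℓ)} := by
      ext L
      exact ⟨fun hL => hL.2, fun hL => ⟨hL ▸ isLagrangian_shiftKer, hL⟩⟩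
    rw [this, Set.image_singleton]
  · rw [H.setOf_isEllEllNeighbor_eq_image fun L hL => H.stabilizer_eq_one_iff hθns hΛ hL,
      Nat.card_image_of_injective (latticeOf_injective H.injective),
      card_lagrangian_shift_stable, hcard]
  · rw [H.setOf_isEllEllNeighbor_eq_image fun L hL => H.stabilizer_eq_two_iff hθns hΛ hL,
      Nat.card_image_of_injective (latticeOf_injective H.injective),
      card_lagrangian_not_shift_stable, hcard]
end
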